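/- (Theorem 4, inner bound for Class II channels.) Let P2 be the set of all joint pmfs p2 on (W,U,X,Y1,Y2) of the form p2(w,u,x,y1,y2) = p(w) p(u|w) p(x|w,u) p(y1,y2|x,w), so that U → (X,W) → (Y1,Y2) is a Markov chain. For p2 ∈ P2, let R_{2,in}(p2) be the convex hull of the set of nonnegative rate pairs (R1,R2) satisfying R1 ≤ I(U;Y1) − I(U;W) and R2 ≤ I(U;Y2) − I(U;W). Then the union ⋃_{p2∈P2} R_{2,in}(p2) is contained in the capacity region C2. -/

import Mathlib

open scoped Classical BigOperators
open Real

noncomputable section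

/-- `p` is a probability mass function on a finite type. -/
def IsPMF {α : Type*} [Fintype α] (p : α → ℝ) : Prop :=
  (∀ a, 0 ≤ p a) ∧ ∑ a, p a = 1

/-- Base-2 Shannon entropy of a pmf on a finite type. -/
def entPMF {α : Type*} [Fintype α] (p : α → ℝ) : ℝ :=
  ∑ a, -(p a * Real.logb 2 (p a))

/-- Distribution (pushforward pmf) of a random variable `X` under the pmf `p`. -/
def distRV {Ω α : Type*} [Fintype Ω] (p : Ω → ℝ) (X : Ω → α) : α → ℝ :=
  fun a => ∑ ω, if X ω = a then p ω else 0

/-- Shannon entropy `H(X)` of a random variable (base 2). -/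
def entRV {Ω α : Type*} [Fintype Ω] [Fintype α] (p : Ω → ℝ) (X : Ω → α) : ℝ :=
  entPMF (distRV p X)

/-- Conditional entropy `H(X|Y)` (base 2). -/
def condEnt {Ω α β : Type*} [Fintype Ω] [Fintype α] [Fintype β]
    (p : Ω → ℝ) (X : Ω → α) (Y : Ω → β) : ℝ :=
  entRV p (fun ω => (X ω, Y ω)) - entRV p Y

/-- Mutual information `I(X;Y)` (base 2). -/
def mutInfo {Ω α β : Type*} [Fintype Ω] [Fintype α] [Fintype β]
    (p : Ω → ℝ) (X : Ω → α) (Y : Ω → β) : ℝ :=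
  entRV p X + entRV p Y - entRV p (fun ω => (X ω, Y ω))

/-- Conditional mutual information `I(X;Y|Z)` (base 2). -/
def condMutInfo {Ω α β γ : Type*} [Fintype Ω] [Fintype α] [Fintype β] [Fintype γ]
    (p : Ω → ℝ) (X : Ω → α) (Y : Ω → β) (Z : Ω → γ) : ℝ :=
  entRV p (fun ω => (X ω, Z ω)) + entRV p (fun ω => (Y ω, Z ω))
    - entRV p (fun ω => (X ω, Y ω, Z ω)) - entRV p Z

/-- A two-user state-dependent discrete memoryless broadcast channel:
state pmf `q` on `𝒲` and channel transition pmf `Q x w (y1,y2)`. -/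
structure SDBC (𝒳 𝒴1 𝒴2 𝒲 : Type) [Fintype 𝒳] [Fintype 𝒴1] [Fintype 𝒴2] [Fintype 𝒲] where
  q : 𝒲 → ℝ
  q_pmf : IsPMF q
  Q : 𝒳 → 𝒲 → 𝒴1 × 𝒴2 → ℝ
  Q_nonneg : ∀ x w y, 0 ≤ Q x w y
  Q_sum : ∀ x w, ∑ y, Q x w y = 1

/-- A Class II code: deterministic encoder with noncausal knowledge of the whole
state sequence, and decoders in which each receiver knows the other receiver's
message. -/
structure CodeII (𝒳 𝒴1 𝒴2 𝒲 : Type) (N K1 K2 : ℕ) where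
  enc : Fin K1 → Fin K2 → (Fin N → 𝒲) → Fin N → 𝒳
  dec1 : (Fin N → 𝒴1) → Fin K2 → Fin K1
  dec2 : (Fin N → 𝒴2) → Fin K1 → Fin K2

variable {𝒳 𝒴1 𝒴2 𝒲 : Type} [Fintype 𝒳] [Fintype 𝒴1] [Fintype 𝒴2] [Fintype 𝒲]

/-- Joint pmf of `(M1, M2, W^N, Y1^N, Y2^N)` induced by uniform independent messages,
the i.i.d. state, the encoder and the memoryless channel. -/
def jointII (ch : SDBC 𝒳 𝒴1 𝒴2 𝒲) {N K1 K2 : ℕ} (c : CodeII 𝒳 𝒴1 𝒴2 𝒲 N K1 K2) :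
    Fin K1 × Fin K2 × (Fin N → 𝒲) × (Fin N → 𝒴1) × (Fin N → 𝒴2) → ℝ :=
  fun ω => (K1 : ℝ)⁻¹ * (K2 : ℝ)⁻¹ * (∏ n, ch.q (ω.2.2.1 n)) *
    ∏ n, ch.Q (c.enc ω.1 ω.2.1 ω.2.2.1 n) (ω.2.2.1 n) (ω.2.2.2.1 n, ω.2.2.2.2 n)

/-- Maximal probability of decoding error of a Class II code (each decoder is
given the message it need not decode). -/
def PeII (ch : SDBC 𝒳 𝒴1 𝒴2 𝒲) {N K1 K2 : ℕ} (c : CodeII 𝒳 𝒴1 𝒴2 𝒲 N K1 K2) : ℝ :=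
  max (∑ ω, if c.dec1 ω.2.2.2.1 ω.2.1 ≠ ω.1 then jointII ch c ω else 0)
      (∑ ω, if c.dec2 ω.2.2.2.2 ω.1 ≠ ω.2.1 then jointII ch c ω else 0)

/-- Achievability of a nonnegative rate pair for the Class II channel. -/
def AchievableII (ch : SDBC 𝒳 𝒴1 𝒴2 𝒲) (R1 R2 : ℝ) : Prop :=
  0 ≤ R1 ∧ 0 ≤ R2 ∧
    ∀ ε : ℝ, 0 < ε → ∃ N0 : ℕ, ∀ N : ℕ, N0 ≤ N →
      ∃ (K1 K2 : ℕ) (c : CodeII 𝒳 𝒴1 𝒴2 𝒲 N K1 K2),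
        (2 : ℝ) ^ ((N : ℝ) * R1) ≤ (K1 : ℝ) ∧ (2 : ℝ) ^ ((N : ℝ) * R2) ≤ (K2 : ℝ) ∧
        PeII ch c ≤ ε

/-- The capacity region `C2`: closure of the set of achievable rate pairs. -/
def CapacityII (ch : SDBC 𝒳 𝒴1 𝒴2 𝒲) : Set (ℝ × ℝ) :=
  closure {R : ℝ × ℝ | AchievableII ch R.1 R.2}

/-- The single-letter joint pmf `p(w) p(u|w) p(x|w,u) p(y1,y2|x,w)`
on `𝒲 × 𝒰 × 𝒳 × 𝒴1 × 𝒴2` determined by auxiliary conditional pmfs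
`pU = p(u|w)` and `pX = p(x|w,u)`; this makes `U → (X,W) → (Y1,Y2)` a Markov chain. -/
def jointP2 (ch : SDBC 𝒳 𝒴1 𝒴2 𝒲) {𝒰 : Type}
    (pU : 𝒲 → 𝒰 → ℝ) (pX : 𝒲 → 𝒰 → 𝒳 → ℝ) :
    𝒲 × 𝒰 × 𝒳 × 𝒴1 × 𝒴2 → ℝ :=
  fun ω => ch.q ω.1 * pU ω.1 ω.2.1 * pX ω.1 ω.2.1 ω.2.2.1 *
    ch.Q ω.2.2.1 ω.1 (ω.2.2.2.1, ω.2.2.2.2)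


section Helpers

lemma sum_pi_prod {ι α : Type} [Fintype ι] [DecidableEq ι] [Fintype α] (f : ι → α → ℝ) :
    ∑ c : ι → α, ∏ j, f j (c j) = ∏ j, ∑ a, f j a := by
  rw [Finset.prod_univ_sum, Fintype.piFinset_univ]

lemma sum_prod0 {ι α : Type} [Fintype ι] [DecidableEq ι] [Fintype α] (P : α → ℝ) (hP : ∑ a, P a = 1) :
    ∑ c : ι → α, ∏ j, P (c j) = 1 := by
  rw [sum_pi_prod (fun _ a => P a)]; simp [hP]

lemma sum_prod2 {ι α : Type} [Fintype ι] [DecidableEq ι] [Fintype α] (P : α → ℝ) (hP : ∑ a, P a = 1)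
    (i k : ι) (hik : i ≠ k) (h g : α → ℝ) :
    ∑ c : ι → α, (∏ j, P (c j)) * (h (c i) * g (c k)) =
      (∑ a, P a * h a) * ∑ a, P a * g a := by
  have e1 : ∀ c : ι → α, (∏ j, P (c j)) * (h (c i) * g (c k)) =
      ∏ j, (P (c j) * ((if j = i then h (c j) else 1) * (if j = k then g (c j) else 1))) := by
    intro c
    rw [Finset.prod_mul_distrib, Finset.prod_mul_distrib]
    simp
  have e2 : ∀ j : ι, ∑ a, (P a * ((if j = i then h a else 1) * (if j = k then g a else 1))) =
      (if j = i then ∑ a, P a * h a else 1) * (if j = k then ∑ a, P a * g a else 1) := by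
    intro j
    by_cases h1 : j = i
    · have h2 : j ≠ k := by rw [h1]; exact hik
      simp [h1, hik]
    · by_cases h2 : j = k
      · simp [h2, hik.symm]
      · simp [h1, h2, hP]
  rw [Finset.sum_congr rfl (fun c _ => e1 c),
    sum_pi_prod (fun j a => P a * ((if j = i then h a else 1) * (if j = k then g a else 1))),
    Finset.prod_congr rfl (fun j _ => e2 j), Finset.prod_mul_distrib]
  simp

lemma sum_prod1 {ι α : Type} [Fintype ι] [DecidableEq ι] [Fintype α] (P : α → ℝ) (hP : ∑ a, P a = 1)
    (i : ι) (h : α → ℝ) :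
    ∑ c : ι → α, (∏ j, P (c j)) * h (c i) = ∑ a, P a * h a := by
  have e1 : ∀ c : ι → α, (∏ j, P (c j)) * h (c i) =
      ∏ j, (P (c j) * (if j = i then h (c j) else 1)) := by
    intro c
    rw [Finset.prod_mul_distrib]
    simp
  have e2 : ∀ j : ι, ∑ a, (P a * (if j = i then h a else 1)) =
      (if j = i then ∑ a, P a * h a else 1) := by
    intro j
    by_cases h1 : j = i
    · simp [h1]
    · simp [h1, hP]
  rw [Finset.sum_congr rfl (fun c _ => e1 c),
    sum_pi_prod (fun j a => P a * (if j = i then h a else 1)),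
    Finset.prod_congr rfl (fun j _ => e2 j)]
  simp

lemma wlln {Ω : Type} [Fintype Ω] (p : Ω → ℝ) (hp0 : ∀ a, 0 ≤ p a) (hp1 : ∑ a, p a = 1)
    (f : Ω → ℝ) : ∃ v : ℝ, 0 ≤ v ∧ ∀ (N : ℕ) (δ : ℝ), 0 < N → 0 < δ →
      ∑ ω : Fin N → Ω, (∏ n, p (ω n)) *
        (if (N : ℝ) * δ ≤ |∑ n, f (ω n) - N * ∑ a, p a * f a| then (1 : ℝ) else 0)
        ≤ v / (N * δ ^ 2) := by
  set μ := ∑ a, p a * f a with hμ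
  refine ⟨∑ a, p a * (f a - μ) ^ 2,
    Finset.sum_nonneg fun a _ => mul_nonneg (hp0 a) (sq_nonneg _), ?_⟩
  intro N δ hN hδ
  have hN' : (0 : ℝ) < N := by exact_mod_cast hN
  have hg : ∑ a, p a * (f a - μ) = 0 := by
    simp only [mul_sub, Finset.sum_sub_distrib]
    rw [← Finset.sum_mul, hp1]; simp [hμ]
  have key : ∑ ω : Fin N → Ω, (∏ n, p (ω n)) * (∑ n, (f (ω n) - μ)) ^ 2
      = N * ∑ a, p a * (f a - μ) ^ 2 := by
    have : ∀ ω : Fin N → Ω, (∏ n, p (ω n)) * (∑ n, (f (ω n) - μ)) ^ 2 =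
        ∑ i, ∑ k, (∏ n, p (ω n)) * ((f (ω i) - μ) * (f (ω k) - μ)) := by
      intro ω
      rw [sq, Finset.sum_mul_sum, Finset.mul_sum]
      simp only [Finset.mul_sum]
    rw [Finset.sum_congr rfl (fun ω _ => this ω), Finset.sum_comm]
    have h2 : ∀ i : Fin N, ∑ ω : Fin N → Ω, ∑ k, (∏ n, p (ω n)) * ((f (ω i) - μ) * (f (ω k) - μ))
        = ∑ a, p a * (f a - μ) ^ 2 := by
      intro i
      rw [Finset.sum_comm, Finset.sum_eq_single i]
      · rw [sum_prod1 p hp1 i (fun a => (f a - μ) * (f a - μ))]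
        simp only [sq]
      · intro k _ hk
        rw [sum_prod2 p hp1 i k hk.symm (fun a => f a - μ) (fun a => f a - μ), hg]; simp
      · simp
    rw [Finset.sum_congr rfl (fun i _ => h2 i)]
    simp
  calc _ ≤ ∑ ω : Fin N → Ω, ((∏ n, p (ω n)) * (∑ n, (f (ω n) - μ)) ^ 2) / (N * δ) ^ 2 := by
        refine Finset.sum_le_sum fun ω _ => ?_
        rw [mul_div_assoc]
        refine mul_le_mul_of_nonneg_left ?_ (Finset.prod_nonneg fun n _ => hp0 _)
        have e : ∑ n, (f (ω n) - μ) = ∑ n, f (ω n) - N * μ := by simp [Finset.sum_sub_distrib]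
        rw [e]
        split_ifs with hc
        · rw [le_div_iff₀ (by positivity), one_mul, ← sq_abs (∑ n, f (ω n) - N * μ)]
          exact pow_le_pow_left₀ (by positivity) hc 2
        · positivity
    _ = _ := by
        rw [← Finset.sum_div, key]
        field_simp

lemma tangent {x y a b : ℝ} (hx : 0 < x) (hy : 0 < y) (ha : 0 < a) (hb : 0 < b) :
    1 / a * (1 / b) * (3 - x / a - y / b) ≤ 1 / x * (1 / y) := by
  have key : ∀ s t : ℝ, 0 < s → 0 < t → s * t * (3 - s - t) ≤ 1 := by
    intro s t hs ht
    nlinarith [mul_nonneg hs.le (sq_nonneg (t - 1)), mul_nonneg ht.le (sq_nonneg (s - 1)),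
      sq_nonneg (s - t), mul_pos hs ht, sq_nonneg (s + t - 2), sq_nonneg (s - 1),
      sq_nonneg (t - 1), mul_nonneg (add_pos hs ht).le (sq_nonneg (s - t)),
      mul_nonneg (add_pos hs ht).le (sq_nonneg (s + t - 2))]
  have h := key (x / a) (y / b) (by positivity) (by positivity)
  have e : 1 / a * (1 / b) * (3 - x / a - y / b) =
      (1 / x * (1 / y)) * (x / a * (y / b) * (3 - x / a - y / b)) := by
    field_simp
  rw [e]
  exact mul_le_of_le_one_right (by positivity) h

lemma core_sub {ι α : Type} [Fintype ι] [DecidableEq ι] [Fintype α] (P : α → ℝ) (hP0 : ∀ a, 0 ≤ P a)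
    (hP : ∑ a, P a = 1) (h ρ : α → ℝ) (hh : ∀ a, 0 ≤ h a) (hρ : ∀ a, 0 ≤ ρ a)
    (hρ1 : ∑ a, P a * ρ a ≤ 1) (i : ι) (J : Finset ι) (hi : i ∈ J) (A : ℝ)
    (hA : (J.card : ℝ) ≤ A) :
    ∑ c : ι → α, (∏ j, P (c j)) * (h (c i) * ((∑ j ∈ J, ρ (c j)) / (ρ (c i) + A)))
      ≤ ∑ a, P a * h a := by
  have hJ : (1 : ℝ) ≤ J.card := by
    exact_mod_cast Finset.card_pos.mpr ⟨i, hi⟩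
  have hA0 : 0 < A := by linarith
  set k : α → ℝ := fun a => h a / (ρ a + A) with hk
  have hpos : ∀ a, 0 < ρ a + A := fun a => by linarith [hρ a]
  have hk0 : ∀ a, 0 ≤ k a := fun a => div_nonneg (hh a) (hpos a).le
  have e1 : ∀ c : ι → α, (∏ j, P (c j)) * (h (c i) * ((∑ j ∈ J, ρ (c j)) / (ρ (c i) + A))) =
      (∏ j, P (c j)) * (k (c i) * ρ (c i)) +
        ∑ j ∈ J.erase i, (∏ j, P (c j)) * (k (c i) * ρ (c j)) := by
    intro c
    rw [← Finset.add_sum_erase J _ hi, ← Finset.mul_sum, ← Finset.mul_sum]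
    simp only [hk]; ring
  rw [Finset.sum_congr rfl (fun c _ => e1 c), Finset.sum_add_distrib, Finset.sum_comm,
    sum_prod1 P hP i (fun a => k a * ρ a)]
  have e2 : ∑ j ∈ J.erase i, ∑ c : ι → α, (∏ j, P (c j)) * (k (c i) * ρ (c j)) =
      ∑ j ∈ J.erase i, (∑ a, P a * k a) * ∑ a, P a * ρ a :=
    Finset.sum_congr rfl fun j hj =>
      sum_prod2 P hP i j (Finset.ne_of_mem_erase hj).symm k ρ
  rw [e2, Finset.sum_const, nsmul_eq_mul]
  have hPk : 0 ≤ ∑ a, P a * k a := Finset.sum_nonneg fun a _ => mul_nonneg (hP0 a) (hk0 a)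
  have hc : ((J.erase i).card : ℝ) ≤ A :=
    le_trans (by exact_mod_cast Finset.card_le_card (Finset.erase_subset i J)) hA
  have e3 : ∑ a, P a * h a = ∑ a, P a * (k a * ρ a) + A * ∑ a, P a * k a := by
    rw [Finset.mul_sum, ← Finset.sum_add_distrib]
    refine Finset.sum_congr rfl fun a _ => ?_
    have := (hpos a).ne'
    simp only [hk]; field_simp
  rw [e3]
  have h5 : (∑ a, P a * k a) * ∑ a, P a * ρ a ≤ ∑ a, P a * k a :=
    mul_le_of_le_one_right hPk hρ1
  have h6 : ((J.erase i).card : ℝ) * ((∑ a, P a * k a) * ∑ a, P a * ρ a) ≤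
      ((J.erase i).card : ℝ) * (∑ a, P a * k a) :=
    mul_le_mul_of_nonneg_left h5 (by positivity)
  have h7 : ((J.erase i).card : ℝ) * (∑ a, P a * k a) ≤ A * (∑ a, P a * k a) :=
    mul_le_mul_of_nonneg_right hc hPk
  linarith

lemma core {ι α : Type} [Fintype ι] [DecidableEq ι] [Fintype α] (P : α → ℝ) (hP0 : ∀ a, 0 ≤ P a)
    (hP : ∑ a, P a = 1) (φ ρ σ : α → ℝ) (hφ : ∀ a, 0 ≤ φ a) (hρ : ∀ a, 0 ≤ ρ a)
    (hσ : ∀ a, 0 ≤ σ a)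
    (hρ1 : ∑ a, P a * ρ a ≤ 1) (hσ1 : ∑ a, P a * σ a ≤ 1)
    (i : ι) (J1 J2 : Finset ι) (hi1 : i ∈ J1) (hi2 : i ∈ J2) (A B : ℝ)
    (hA : (J1.card : ℝ) ≤ A) (hB : (J2.card : ℝ) ≤ B) :
    ∑ a, P a * (φ a * (ρ a / (ρ a + A)) * (σ a / (σ a + B))) ≤
    ∑ c : ι → α, (∏ j, P (c j)) *
      (φ (c i) * (ρ (c i) / ∑ j ∈ J1, ρ (c j)) * (σ (c i) / ∑ j ∈ J2, σ (c j))) := by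
  have hJ1 : (1 : ℝ) ≤ J1.card := by exact_mod_cast Finset.card_pos.mpr ⟨i, hi1⟩
  have hJ2 : (1 : ℝ) ≤ J2.card := by exact_mod_cast Finset.card_pos.mpr ⟨i, hi2⟩
  have hA0 : 0 < A := by linarith
  have hB0 : 0 < B := by linarith
  set h : α → ℝ := fun a => φ a * (ρ a / (ρ a + A)) * (σ a / (σ a + B)) with hh
  have hh0 : ∀ a, 0 ≤ h a := fun a => by
    have := hφ a; have := hρ a; have := hσ a
    simp only [hh]; positivity
  have s1 := core_sub P hP0 hP h ρ hh0 hρ hρ1 i J1 hi1 A hA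
  have s2 := core_sub P hP0 hP h σ hh0 hσ hσ1 i J2 hi2 B hB
  have s3 := sum_prod1 P hP i h
  have pt : ∀ c : ι → α, h (c i) * (3 - (∑ j ∈ J1, ρ (c j)) / (ρ (c i) + A)
        - (∑ j ∈ J2, σ (c j)) / (σ (c i) + B)) ≤
      φ (c i) * (ρ (c i) / ∑ j ∈ J1, ρ (c j)) * (σ (c i) / ∑ j ∈ J2, σ (c j)) := by
    intro c
    rcases (hρ (c i)).eq_or_lt with h0 | h0
    · simp [hh, ← h0]
    rcases (hσ (c i)).eq_or_lt with h1 | h1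
    · simp [hh, ← h1]
    have x0 : 0 < ∑ j ∈ J1, ρ (c j) :=
      lt_of_lt_of_le h0 (Finset.single_le_sum (f := fun j => ρ (c j)) (fun j _ => hρ _) hi1)
    have y0 : 0 < ∑ j ∈ J2, σ (c j) :=
      lt_of_lt_of_le h1 (Finset.single_le_sum (f := fun j => σ (c j)) (fun j _ => hσ _) hi2)
    have t := tangent x0 y0 (show 0 < ρ (c i) + A by linarith) (show 0 < σ (c i) + B by linarith)
    have t2 := mul_le_mul_of_nonneg_left t
      (mul_nonneg (mul_nonneg (hφ (c i)) (hρ (c i))) (hσ (c i)))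
    simp only [hh]
    calc _ = _ := ?_
      _ ≤ _ := t2
      _ = _ := by ring
    ring
  have : ∑ c : ι → α, (∏ j, P (c j)) * (h (c i) * (3 - (∑ j ∈ J1, ρ (c j)) / (ρ (c i) + A)
        - (∑ j ∈ J2, σ (c j)) / (σ (c i) + B))) ≤ ∑ c : ι → α, (∏ j, P (c j)) *
      (φ (c i) * (ρ (c i) / ∑ j ∈ J1, ρ (c j)) * (σ (c i) / ∑ j ∈ J2, σ (c j))) :=
    Finset.sum_le_sum fun c _ =>
      mul_le_mul_of_nonneg_left (pt c) (Finset.prod_nonneg fun j _ => hP0 _)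
  refine le_trans ?_ this
  have e : ∀ c : ι → α, (∏ j, P (c j)) * (h (c i) * (3 - (∑ j ∈ J1, ρ (c j)) / (ρ (c i) + A)
        - (∑ j ∈ J2, σ (c j)) / (σ (c i) + B))) =
      3 * ((∏ j, P (c j)) * h (c i))
      - (∏ j, P (c j)) * (h (c i) * ((∑ j ∈ J1, ρ (c j)) / (ρ (c i) + A)))
      - (∏ j, P (c j)) * (h (c i) * ((∑ j ∈ J2, σ (c j)) / (σ (c i) + B))) := by
    intro c; ring
  rw [Finset.sum_congr rfl (fun c _ => e c), Finset.sum_sub_distrib, Finset.sum_sub_distrib,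
    ← Finset.mul_sum, s3]
  linarith

lemma pick {T I α : Type} [Fintype T] [Fintype I] [Fintype α] [DecidableEq α] [Nonempty α]
    (F : I → α → ℝ) (hF0 : ∀ i a, 0 ≤ F i a) (hF1 : ∀ i, ∑ a, F i a ≤ 1)
    (k : T → I) (s : T → α) (G : T → ℝ) (hG : ∀ t, 0 ≤ G t) :
    ∃ f : I → α, ∑ t, F (k t) (s t) * G t ≤ ∑ t, (if f (k t) = s t then 1 else 0) * G t := by
  set g : I → α → ℝ := fun i a => ∑ t, if k t = i ∧ s t = a then G t else 0 with hg
  have hg0 : ∀ i a, 0 ≤ g i a := fun i a => Finset.sum_nonneg fun t _ => by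
    split_ifs; exacts [hG t, le_rfl]
  have e : ∀ H : I → α → ℝ, ∑ t, H (k t) (s t) * G t = ∑ i, ∑ a, H i a * g i a := by
    intro H
    have : ∀ i, ∑ a, H i a * g i a = ∑ t, if k t = i then H i (s t) * G t else 0 := by
      intro i
      simp only [hg, Finset.mul_sum]
      rw [Finset.sum_comm]
      refine Finset.sum_congr rfl fun t _ => ?_
      by_cases hk : k t = i
      · simp [hk]
      · simp [hk]
    rw [Finset.sum_congr rfl (fun i _ => this i), Finset.sum_comm]
    simp
  choose f hf using fun i => Finite.exists_max (g i)
  refine ⟨f, ?_⟩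
  rw [e F, e (fun i a => if f i = a then 1 else 0)]
  refine Finset.sum_le_sum fun i _ => ?_
  simp only [ite_mul, one_mul, zero_mul, Finset.sum_ite_eq, Finset.mem_univ, if_true]
  calc ∑ a, F i a * g i a ≤ ∑ a, F i a * g i (f i) :=
        Finset.sum_le_sum fun a _ => mul_le_mul_of_nonneg_left (hf i a) (hF0 i a)
    _ = (∑ a, F i a) * g i (f i) := by rw [Finset.sum_mul]
    _ ≤ g i (f i) := mul_le_of_le_one_left (hg0 _ _) (hF1 i)


lemma avg_gen {T M U : Type} [Fintype T] [Fintype M] [DecidableEq M] [Fintype U] {L : ℕ}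
    (P : U → ℝ) (hP0 : ∀ a, 0 ≤ P a) (hP : ∑ a, P a = 1)
    (m : T → M) (g : T → ℝ) (hg : ∀ t, 0 ≤ g t)
    (φ ρ σ : T → U → ℝ) (hφ : ∀ t a, 0 ≤ φ t a) (hρ : ∀ t a, 0 ≤ ρ t a) (hσ : ∀ t a, 0 ≤ σ t a)
    (hρ1 : ∀ t, ∑ a, P a * ρ t a ≤ 1) (hσ1 : ∀ t, ∑ a, P a * σ t a ≤ 1)
    (J : T → Finset (M × Fin L)) (hJ : ∀ t l, (m t, l) ∈ J t) (B : ℝ)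
    (hB : ∀ t, ((J t).card : ℝ) ≤ B) :
    ∑ t, g t * (L * ∑ a, P a * (φ t a * (ρ t a / (ρ t a + L)) * (σ t a / (σ t a + B)))) ≤
    ∑ c : M × Fin L → U, (∏ j, P (c j)) * ∑ t, g t *
      ((∑ l, φ t (c (m t, l)) * (ρ t (c (m t, l)) / ∑ l', ρ t (c (m t, l')))) *
        (∑ l, σ t (c (m t, l)) / ∑ j ∈ J t, σ t (c j))) := by
  have step : ∀ (t : T) (l : Fin L),
      ∑ a, P a * (φ t a * (ρ t a / (ρ t a + L)) * (σ t a / (σ t a + B))) ≤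
      ∑ c : M × Fin L → U, (∏ j, P (c j)) *
      (φ t (c (m t, l)) * (ρ t (c (m t, l)) / ∑ l', ρ t (c (m t, l'))) *
        (σ t (c (m t, l)) / ∑ j ∈ J t, σ t (c j))) := by
    intro t l
    have inj : Function.Injective (fun l' : Fin L => (m t, l')) := fun a b h => (Prod.mk.inj h).2
    have h := core P hP0 hP (φ t) (ρ t) (σ t) (hφ t) (hρ t) (hσ t) (hρ1 t) (hσ1 t) (m t, l)
      (Finset.univ.image (fun l' : Fin L => (m t, l'))) (J t) (by simp) (hJ t l) L B
      (by rw [Finset.card_image_of_injective _ inj]; simp) (hB t)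
    simpa only [Finset.sum_image inj.injOn] using h
  calc ∑ t, g t * (L * ∑ a, P a * (φ t a * (ρ t a / (ρ t a + L)) * (σ t a / (σ t a + B))))
      = ∑ t, g t * ∑ l : Fin L,
        ∑ a, P a * (φ t a * (ρ t a / (ρ t a + L)) * (σ t a / (σ t a + B))) := by simp
    _ ≤ ∑ t, g t * ∑ l : Fin L, ∑ c : M × Fin L → U, (∏ j, P (c j)) *
      (φ t (c (m t, l)) * (ρ t (c (m t, l)) / ∑ l', ρ t (c (m t, l'))) *
        (σ t (c (m t, l)) / ∑ j ∈ J t, σ t (c j))) :=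
      Finset.sum_le_sum fun t _ => mul_le_mul_of_nonneg_left
        (Finset.sum_le_sum fun l _ => step t l) (hg t)
    _ = ∑ c : M × Fin L → U, (∏ j, P (c j)) * ∑ t, g t * ∑ l : Fin L,
      (φ t (c (m t, l)) * (ρ t (c (m t, l)) / ∑ l', ρ t (c (m t, l'))) *
        (σ t (c (m t, l)) / ∑ j ∈ J t, σ t (c j))) := by
      simp only [Finset.mul_sum]
      rw [Finset.sum_comm]
      rw [Finset.sum_congr rfl (fun t _ => Finset.sum_comm), Finset.sum_comm]
      rw [Finset.sum_congr rfl (fun t _ => Finset.sum_comm)]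
      refine Finset.sum_congr rfl fun c _ => Finset.sum_congr rfl fun t _ =>
        Finset.sum_congr rfl fun l _ => ?_
      ring
    _ ≤ _ := by
      refine Finset.sum_le_sum fun c _ => mul_le_mul_of_nonneg_left
        (Finset.sum_le_sum fun t _ => mul_le_mul_of_nonneg_left ?_ (hg t))
        (Finset.prod_nonneg fun j _ => hP0 _)
      rw [Finset.sum_mul]
      refine Finset.sum_le_sum fun l _ => mul_le_mul_of_nonneg_left ?_ ?_
      · exact Finset.single_le_sum (f := fun l => σ t (c (m t, l)) / ∑ j ∈ J t, σ t (c j))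
          (fun l _ => div_nonneg (hσ _ _) (Finset.sum_nonneg fun j _ => hσ _ _))
          (Finset.mem_univ l)
      · exact mul_nonneg (hφ _ _) (div_nonneg (hρ _ _) (Finset.sum_nonneg fun j _ => hρ _ _))

lemma oneshot {W U X Y1 Y2 : Type} [Fintype W] [Fintype U] [Fintype X] [Fintype Y1] [Fintype Y2]
    [DecidableEq X] [Nonempty X]
    (q : W → ℝ) (hq : ∀ w, 0 ≤ q w)
    (pX : W → U → X → ℝ) (hpX0 : ∀ w u x, 0 ≤ pX w u x) (hpX1 : ∀ w u, ∑ x, pX w u x = 1)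
    (Q : X → W → Y1 → Y2 → ℝ) (hQ : ∀ x w y1 y2, 0 ≤ Q x w y1 y2)
    (P : U → ℝ) (hP0 : ∀ a, 0 ≤ P a) (hP : ∑ a, P a = 1)
    (ρ : U → W → ℝ) (hρ : ∀ u w, 0 ≤ ρ u w) (hρ1 : ∀ w, ∑ u, P u * ρ u w ≤ 1)
    (σ1 : U → Y1 → ℝ) (hσ1 : ∀ u y, 0 ≤ σ1 u y) (hσ11 : ∀ y, ∑ u, P u * σ1 u y ≤ 1)
    (σ2 : U → Y2 → ℝ) (hσ2 : ∀ u y, 0 ≤ σ2 u y) (hσ21 : ∀ y, ∑ u, P u * σ2 u y ≤ 1)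
    (K1 K2 L : ℕ) (hK1 : 0 < K1) (hK2 : 0 < K2)
    (A1 A2 : ℝ) (hA1 : 0 ≤ A1) (hA2 : 0 ≤ A2) :
    ∃ (enc : Fin K1 × Fin K2 × W → X) (dec1 : Y1 × Fin K2 → Fin K1)
      (dec2 : Y2 × Fin K1 → Fin K2),
      A1 * (∑ s : W × X × Y1 × Y2, q s.1 * Q s.2.1 s.1 s.2.2.1 s.2.2.2 *
        (L * ∑ u, P u * (pX s.1 u s.2.1 * (ρ u s.1 / (ρ u s.1 + L)) *
          (σ1 u s.2.2.1 / (σ1 u s.2.2.1 + K1 * L))))) +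
      A2 * (∑ s : W × X × Y1 × Y2, q s.1 * Q s.2.1 s.1 s.2.2.1 s.2.2.2 *
        (L * ∑ u, P u * (pX s.1 u s.2.1 * (ρ u s.1 / (ρ u s.1 + L)) *
          (σ2 u s.2.2.2 / (σ2 u s.2.2.2 + K2 * L))))) ≤
      ∑ t : (Fin K1 × Fin K2) × W × X × Y1 × Y2,
        (if enc (t.1.1, t.1.2, t.2.1) = t.2.2.1 then 1 else 0) *
        ((K1 : ℝ)⁻¹ * (K2 : ℝ)⁻¹ * (q t.2.1 * Q t.2.2.1 t.2.1 t.2.2.2.1 t.2.2.2.2) *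
          (A1 * (if dec1 (t.2.2.2.1, t.1.2) = t.1.1 then 1 else 0) +
           A2 * (if dec2 (t.2.2.2.2, t.1.1) = t.1.2 then 1 else 0))) := by
  have : Nonempty (Fin K1) := ⟨⟨0, hK1⟩⟩
  have : Nonempty (Fin K2) := ⟨⟨0, hK2⟩⟩
  set g : (Fin K1 × Fin K2) × W × X × Y1 × Y2 → ℝ := fun t =>
    (K1 : ℝ)⁻¹ * (K2 : ℝ)⁻¹ * (q t.2.1 * Q t.2.2.1 t.2.1 t.2.2.2.1 t.2.2.2.2) with hgdef
  have hg : ∀ t, 0 ≤ g t := fun t => by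
    have := hq t.2.1; have := hQ t.2.2.1 t.2.1 t.2.2.2.1 t.2.2.2.2
    simp only [hgdef]; positivity
  -- reduction of the message averages
  have red : ∀ f : W × X × Y1 × Y2 → ℝ,
      ∑ t : (Fin K1 × Fin K2) × W × X × Y1 × Y2, g t * f t.2 =
        ∑ s : W × X × Y1 × Y2, q s.1 * Q s.2.1 s.1 s.2.2.1 s.2.2.2 * f s := by
    intro f
    rw [Fintype.sum_prod_type]
    simp only [hgdef, mul_assoc, ← Finset.mul_sum]
    rw [Finset.sum_const, Finset.card_univ, Fintype.card_prod, Fintype.card_fin, Fintype.card_fin]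
    rw [nsmul_eq_mul]
    have h1 : (K1 : ℝ) ≠ 0 := by positivity
    have h2 : (K2 : ℝ) ≠ 0 := by positivity
    push_cast
    field_simp
  set J1 : Fin K2 → Finset ((Fin K1 × Fin K2) × Fin L) := fun m2 =>
    Finset.univ.image (fun a : Fin K1 × Fin L => ((a.1, m2), a.2)) with hJ1
  set J2 : Fin K1 → Finset ((Fin K1 × Fin K2) × Fin L) := fun m1 =>
    Finset.univ.image (fun a : Fin K2 × Fin L => ((m1, a.1), a.2)) with hJ2
  have inj1 : ∀ m2 : Fin K2,
      Function.Injective (fun a : Fin K1 × Fin L => (((a.1, m2), a.2) : (Fin K1 × Fin K2) × Fin L)) := by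
    rintro m2 ⟨a, b⟩ ⟨c, d⟩ h; simpa using h
  have inj2 : ∀ m1 : Fin K1,
      Function.Injective (fun a : Fin K2 × Fin L => (((m1, a.1), a.2) : (Fin K1 × Fin K2) × Fin L)) := by
    rintro m1 ⟨a, b⟩ ⟨c, d⟩ h; simpa using h
  have av1 := avg_gen (T := (Fin K1 × Fin K2) × W × X × Y1 × Y2) (L := L) P hP0 hP
    (fun t => t.1) g hg (fun t u => pX t.2.1 u t.2.2.1) (fun t u => ρ u t.2.1)
    (fun t u => σ1 u t.2.2.2.1) (fun t u => hpX0 _ _ _) (fun t u => hρ _ _) (fun t u => hσ1 _ _)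
    (fun t => hρ1 _) (fun t => hσ11 _) (fun t => J1 t.1.2)
    (fun t l => by simp [hJ1]) (K1 * L)
    (fun t => by simp only [hJ1]; rw [Finset.card_image_of_injective _ (inj1 _)]; simp)
  have av2 := avg_gen (T := (Fin K1 × Fin K2) × W × X × Y1 × Y2) (L := L) P hP0 hP
    (fun t => t.1) g hg (fun t u => pX t.2.1 u t.2.2.1) (fun t u => ρ u t.2.1)
    (fun t u => σ2 u t.2.2.2.2) (fun t u => hpX0 _ _ _) (fun t u => hρ _ _) (fun t u => hσ2 _ _)
    (fun t => hρ1 _) (fun t => hσ21 _) (fun t => J2 t.1.1)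
    (fun t l => by simp [hJ2]) (K2 * L)
    (fun t => by simp only [hJ2]; rw [Finset.card_image_of_injective _ (inj2 _)]; simp)
  rw [red (fun s => (L * ∑ u, P u * (pX s.1 u s.2.1 * (ρ u s.1 / (ρ u s.1 + L)) *
          (σ1 u s.2.2.1 / (σ1 u s.2.2.1 + K1 * L)))))] at av1
  rw [red (fun s => (L * ∑ u, P u * (pX s.1 u s.2.1 * (ρ u s.1 / (ρ u s.1 + L)) *
          (σ2 u s.2.2.2 / (σ2 u s.2.2.2 + K2 * L)))))] at av2
  -- stochastic code
  set E : ((Fin K1 × Fin K2) × Fin L → U) → (Fin K1 × Fin K2 × W) → X → ℝ := fun c i x =>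
    ∑ l, pX i.2.2 (c ((i.1, i.2.1), l)) x *
      (ρ (c ((i.1, i.2.1), l)) i.2.2 / ∑ l', ρ (c ((i.1, i.2.1), l')) i.2.2) with hE
  set D1 : ((Fin K1 × Fin K2) × Fin L → U) → Y1 × Fin K2 → Fin K1 → ℝ := fun c i m1 =>
    ∑ l, σ1 (c ((m1, i.2), l)) i.1 / ∑ j ∈ J1 i.2, σ1 (c j) i.1 with hD1
  set D2 : ((Fin K1 × Fin K2) × Fin L → U) → Y2 × Fin K1 → Fin K2 → ℝ := fun c i m2 =>
    ∑ l, σ2 (c ((i.2, m2), l)) i.1 / ∑ j ∈ J2 i.2, σ2 (c j) i.1 with hD2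
  have hE0 : ∀ c i x, 0 ≤ E c i x := fun c i x => Finset.sum_nonneg fun l _ =>
    mul_nonneg (hpX0 _ _ _) (div_nonneg (hρ _ _) (Finset.sum_nonneg fun _ _ => hρ _ _))
  have hD10 : ∀ c i x, 0 ≤ D1 c i x := fun c i x => Finset.sum_nonneg fun l _ =>
    (div_nonneg (hσ1 _ _) (Finset.sum_nonneg fun _ _ => hσ1 _ _))
  have hD20 : ∀ c i x, 0 ≤ D2 c i x := fun c i x => Finset.sum_nonneg fun l _ =>
    (div_nonneg (hσ2 _ _) (Finset.sum_nonneg fun _ _ => hσ2 _ _))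
  have hE1 : ∀ c i, ∑ x, E c i x ≤ 1 := by
    intro c i
    simp only [hE]
    rw [Finset.sum_comm]
    simp only [← Finset.sum_mul, hpX1, one_mul, ← Finset.sum_div]
    exact div_self_le_one _
  have hD11 : ∀ c i, ∑ m, D1 c i m ≤ 1 := by
    intro c i
    simp only [hD1, hJ1]
    simp only [← Finset.sum_div, Finset.sum_image (inj1 _).injOn]
    rw [Fintype.sum_prod_type]
    exact div_self_le_one _
  have hD21 : ∀ c i, ∑ m, D2 c i m ≤ 1 := by
    intro c i
    simp only [hD2, hJ2]
    simp only [← Finset.sum_div, Finset.sum_image (inj2 _).injOn]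
    rw [Fintype.sum_prod_type]
    exact div_self_le_one _
  -- pick the codebook
  set S1 := ∑ s : W × X × Y1 × Y2, q s.1 * Q s.2.1 s.1 s.2.2.1 s.2.2.2 *
        (L * ∑ u, P u * (pX s.1 u s.2.1 * (ρ u s.1 / (ρ u s.1 + L)) *
          (σ1 u s.2.2.1 / (σ1 u s.2.2.1 + K1 * L)))) with hS1
  set S2 := ∑ s : W × X × Y1 × Y2, q s.1 * Q s.2.1 s.1 s.2.2.1 s.2.2.2 *
        (L * ∑ u, P u * (pX s.1 u s.2.1 * (ρ u s.1 / (ρ u s.1 + L)) *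
          (σ2 u s.2.2.2 / (σ2 u s.2.2.2 + K2 * L)))) with hS2
  set V : ((Fin K1 × Fin K2) × Fin L → U) → ℝ := fun c =>
    A1 * (∑ t : (Fin K1 × Fin K2) × W × X × Y1 × Y2, g t * (E c (t.1.1, t.1.2, t.2.1) t.2.2.1 *
      D1 c (t.2.2.2.1, t.1.2) t.1.1)) +
    A2 * (∑ t : (Fin K1 × Fin K2) × W × X × Y1 × Y2, g t * (E c (t.1.1, t.1.2, t.2.1) t.2.2.1 *
      D2 c (t.2.2.2.2, t.1.1) t.1.2)) with hV
  obtain ⟨c, hc⟩ : ∃ c, A1 * S1 + A2 * S2 ≤ V c := by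
    by_contra hcon
    push Not at hcon
    have h1 : A1 * S1 + A2 * S2 ≤ ∑ c, (∏ j, P (c j)) * V c := by
      have e : ∑ c, (∏ j, P (c j)) * V c =
        A1 * ∑ c, (∏ j, P (c j)) * (∑ t : (Fin K1 × Fin K2) × W × X × Y1 × Y2,
          g t * (E c (t.1.1, t.1.2, t.2.1) t.2.2.1 * D1 c (t.2.2.2.1, t.1.2) t.1.1)) +
        A2 * ∑ c, (∏ j, P (c j)) * (∑ t : (Fin K1 × Fin K2) × W × X × Y1 × Y2,
          g t * (E c (t.1.1, t.1.2, t.2.1) t.2.2.1 * D2 c (t.2.2.2.2, t.1.1) t.1.2)) := by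
        rw [Finset.mul_sum, Finset.mul_sum, ← Finset.sum_add_distrib]
        refine Finset.sum_congr rfl fun c _ => ?_
        simp only [hV]; ring
      rw [e]
      exact add_le_add (mul_le_mul_of_nonneg_left av1 hA1) (mul_le_mul_of_nonneg_left av2 hA2)
    have hsum : ∑ c : (Fin K1 × Fin K2) × Fin L → U, ∏ j, P (c j) = 1 := sum_prod0 P hP
    have h2 : ∑ c, (∏ j, P (c j)) * V c <
        ∑ c : (Fin K1 × Fin K2) × Fin L → U, (∏ j, P (c j)) * (A1 * S1 + A2 * S2) := by
      have hnn : ∀ c : (Fin K1 × Fin K2) × Fin L → U, 0 ≤ ∏ j, P (c j) :=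
        fun c => Finset.prod_nonneg fun j _ => hP0 _
      obtain ⟨c, hc⟩ : ∃ c : (Fin K1 × Fin K2) × Fin L → U, 0 < ∏ j, P (c j) := by
        by_contra hno
        push Not at hno
        have : ∑ c : (Fin K1 × Fin K2) × Fin L → U, ∏ j, P (c j) ≤ 0 :=
          Finset.sum_nonpos fun c _ => hno c
        linarith
      exact Finset.sum_lt_sum (fun c _ => mul_le_mul_of_nonneg_left (hcon c).le (hnn c))
        ⟨c, Finset.mem_univ _, mul_lt_mul_of_pos_left (hcon c) hc⟩
    rw [← Finset.sum_mul, hsum, one_mul] at h2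
    linarith
  -- derandomize
  obtain ⟨dec1, hd1⟩ := pick (D1 c) (hD10 c) (hD11 c)
    (fun t : (Fin K1 × Fin K2) × W × X × Y1 × Y2 => (t.2.2.2.1, t.1.2)) (fun t => t.1.1)
    (fun t => g t * E c (t.1.1, t.1.2, t.2.1) t.2.2.1) (fun t => mul_nonneg (hg t) (hE0 _ _ _))
  obtain ⟨dec2, hd2⟩ := pick (D2 c) (hD20 c) (hD21 c)
    (fun t : (Fin K1 × Fin K2) × W × X × Y1 × Y2 => (t.2.2.2.2, t.1.1)) (fun t => t.1.2)
    (fun t => g t * E c (t.1.1, t.1.2, t.2.1) t.2.2.1) (fun t => mul_nonneg (hg t) (hE0 _ _ _))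
  obtain ⟨enc, hen⟩ := pick (E c) (hE0 c) (hE1 c)
    (fun t : (Fin K1 × Fin K2) × W × X × Y1 × Y2 => (t.1.1, t.1.2, t.2.1)) (fun t => t.2.2.1)
    (fun t => g t * (A1 * (if dec1 (t.2.2.2.1, t.1.2) = t.1.1 then 1 else 0) +
           A2 * (if dec2 (t.2.2.2.2, t.1.1) = t.1.2 then 1 else 0)))
    (fun t => mul_nonneg (hg t) (by positivity))
  refine ⟨enc, dec1, dec2, le_trans hc (le_trans ?_ hen)⟩
  have e1 : ∑ t : (Fin K1 × Fin K2) × W × X × Y1 × Y2, E c (t.1.1, t.1.2, t.2.1) t.2.2.1 *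
      (g t * (A1 * (if dec1 (t.2.2.2.1, t.1.2) = t.1.1 then 1 else 0) +
           A2 * (if dec2 (t.2.2.2.2, t.1.1) = t.1.2 then 1 else 0))) =
      A1 * (∑ t : (Fin K1 × Fin K2) × W × X × Y1 × Y2,
        (if dec1 (t.2.2.2.1, t.1.2) = t.1.1 then 1 else 0) *
          (g t * E c (t.1.1, t.1.2, t.2.1) t.2.2.1)) +
      A2 * (∑ t : (Fin K1 × Fin K2) × W × X × Y1 × Y2,
        (if dec2 (t.2.2.2.2, t.1.1) = t.1.2 then 1 else 0) *
          (g t * E c (t.1.1, t.1.2, t.2.1) t.2.2.1)) := by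
    rw [Finset.mul_sum, Finset.mul_sum, ← Finset.sum_add_distrib]
    refine Finset.sum_congr rfl fun t _ => ?_
    ring
  rw [e1]
  refine le_trans (le_of_eq ?_)
    (add_le_add (mul_le_mul_of_nonneg_left hd1 hA1) (mul_le_mul_of_nonneg_left hd2 hA2))
  simp only [hV]
  congr 2
  · exact Finset.sum_congr rfl fun t _ => by ring
  · exact Finset.sum_congr rfl fun t _ => by ring


lemma distRV_nonneg {Ω α : Type} [Fintype Ω] (p : Ω → ℝ) (hp : ∀ ω, 0 ≤ p ω) (X : Ω → α) (a : α) :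
    0 ≤ distRV p X a :=
  Finset.sum_nonneg fun ω _ => by split_ifs; exacts [hp ω, le_rfl]

lemma distRV_expect {Ω α : Type} [Fintype Ω] [Fintype α] (p : Ω → ℝ) (X : Ω → α) (f : α → ℝ) :
    ∑ a, distRV p X a * f a = ∑ ω, p ω * f (X ω) := by
  simp only [distRV, Finset.sum_mul]
  rw [Finset.sum_comm]
  refine Finset.sum_congr rfl fun ω _ => ?_
  simp

lemma distRV_sum {Ω α : Type} [Fintype Ω] [Fintype α] (p : Ω → ℝ) (hp1 : ∑ ω, p ω = 1)
    (X : Ω → α) : ∑ a, distRV p X a = 1 := by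
  have := distRV_expect p X (fun _ => 1)
  simpa [hp1] using this

lemma le_distRV {Ω α : Type} [Fintype Ω] (p : Ω → ℝ) (hp : ∀ ω, 0 ≤ p ω) (X : Ω → α) (ω : Ω) :
    p ω ≤ distRV p X (X ω) := by
  have := Finset.single_le_sum (f := fun ω' => if X ω' = X ω then p ω' else 0)
    (fun ω' _ => by split_ifs; exacts [hp ω', le_rfl]) (Finset.mem_univ ω)
  simpa [distRV] using this

lemma distRV_pair_sum {Ω α β : Type} [Fintype Ω] [Fintype α] (p : Ω → ℝ)
    (X : Ω → α) (Y : Ω → β) (b : β) :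
    ∑ a, distRV p (fun ω => (X ω, Y ω)) (a, b) = distRV p Y b := by
  simp only [distRV]
  rw [Finset.sum_comm]
  refine Finset.sum_congr rfl fun ω _ => ?_
  by_cases h : Y ω = b <;> simp [h]

lemma distRV_pair_sum' {Ω α β : Type} [Fintype Ω] [Fintype β] (p : Ω → ℝ)
    (X : Ω → α) (Y : Ω → β) (a : α) :
    ∑ b, distRV p (fun ω => (X ω, Y ω)) (a, b) = distRV p X a := by
  simp only [distRV]
  rw [Finset.sum_comm]
  refine Finset.sum_congr rfl fun ω _ => ?_
  by_cases h : X ω = a <;> simp [h]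

/-- Information density ratio. -/
def densRV {Ω α β : Type} [Fintype Ω] (p : Ω → ℝ) (X : Ω → α) (Y : Ω → β) (a : α) (b : β) : ℝ :=
  distRV p (fun ω => (X ω, Y ω)) (a, b) / (distRV p X a * distRV p Y b)

lemma densRV_nonneg {Ω α β : Type} [Fintype Ω] (p : Ω → ℝ) (hp : ∀ ω, 0 ≤ p ω)
    (X : Ω → α) (Y : Ω → β) (a : α) (b : β) : 0 ≤ densRV p X Y a b :=
  div_nonneg (distRV_nonneg p hp _ _)
    (mul_nonneg (distRV_nonneg p hp _ _) (distRV_nonneg p hp _ _))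

lemma densRV_pos {Ω α β : Type} [Fintype Ω] (p : Ω → ℝ) (hp : ∀ ω, 0 ≤ p ω)
    (X : Ω → α) (Y : Ω → β) (ω : Ω) (h : 0 < p ω) : 0 < densRV p X Y (X ω) (Y ω) :=
  div_pos (h.trans_le (le_distRV p hp (fun ω => (X ω, Y ω)) ω))
    (mul_pos (h.trans_le (le_distRV p hp X ω)) (h.trans_le (le_distRV p hp Y ω)))

lemma densRV_mul {Ω α β : Type} [Fintype Ω] [Fintype α] [Fintype β] (p : Ω → ℝ)
    (hp : ∀ ω, 0 ≤ p ω) (X : Ω → α) (Y : Ω → β) (a : α) (b : β) :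
    distRV p X a * distRV p Y b * densRV p X Y a b = distRV p (fun ω => (X ω, Y ω)) (a, b) := by
  have h0 := distRV_nonneg p hp (fun ω => (X ω, Y ω)) (a, b)
  by_cases hX : distRV p X a = 0
  · have : distRV p (fun ω => (X ω, Y ω)) (a, b) ≤ 0 := by
      rw [← hX, ← distRV_pair_sum' p X Y a]
      exact Finset.single_le_sum (f := fun b => distRV p (fun ω => (X ω, Y ω)) (a, b))
        (fun b _ => distRV_nonneg p hp _ _) (Finset.mem_univ b)
    rw [hX]; linarith
  by_cases hY : distRV p Y b = 0
  · have : distRV p (fun ω => (X ω, Y ω)) (a, b) ≤ 0 := by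
      rw [← hY, ← distRV_pair_sum p X Y b]
      exact Finset.single_le_sum (f := fun a => distRV p (fun ω => (X ω, Y ω)) (a, b))
        (fun b _ => distRV_nonneg p hp _ _) (Finset.mem_univ a)
    rw [hY]; linarith
  unfold densRV
  field_simp

lemma densRV_sum {Ω α β : Type} [Fintype Ω] [Fintype α] [Fintype β] (p : Ω → ℝ)
    (hp : ∀ ω, 0 ≤ p ω) (X : Ω → α) (Y : Ω → β) (b : β) :
    ∑ a, distRV p X a * densRV p X Y a b ≤ 1 := by
  by_cases hY : distRV p Y b = 0
  · simp [densRV, hY]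
  have h : distRV p Y b * ∑ a, distRV p X a * densRV p X Y a b = distRV p Y b * 1 := by
    rw [Finset.mul_sum, mul_one, ← distRV_pair_sum p X Y b]
    refine Finset.sum_congr rfl fun a _ => ?_
    rw [← densRV_mul p hp X Y a b, distRV_pair_sum p X Y b]
    ring
  exact (mul_left_cancel₀ hY h).le

lemma entRV_eq {Ω α : Type} [Fintype Ω] [Fintype α] (p : Ω → ℝ) (X : Ω → α) :
    entRV p X = - ∑ ω, p ω * Real.logb 2 (distRV p X (X ω)) := by
  rw [← distRV_expect p X (fun a => Real.logb 2 (distRV p X a))]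
  simp [entRV, entPMF]

lemma mutInfo_eq {Ω α β : Type} [Fintype Ω] [Fintype α] [Fintype β] (p : Ω → ℝ)
    (hp : ∀ ω, 0 ≤ p ω) (X : Ω → α) (Y : Ω → β) :
    mutInfo p X Y = ∑ ω, p ω * Real.logb 2 (densRV p X Y (X ω) (Y ω)) := by
  unfold mutInfo
  rw [entRV_eq, entRV_eq, entRV_eq]
  have : ∀ ω, p ω * Real.logb 2 (densRV p X Y (X ω) (Y ω)) =
      p ω * Real.logb 2 (distRV p (fun ω => (X ω, Y ω)) (X ω, Y ω)) -
      p ω * Real.logb 2 (distRV p X (X ω)) - p ω * Real.logb 2 (distRV p Y (Y ω)) := by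
    intro ω
    rcases (hp ω).eq_or_lt with h | h
    · simp [← h]
    have h1 := h.trans_le (le_distRV p hp (fun ω => (X ω, Y ω)) ω)
    have h2 := h.trans_le (le_distRV p hp X ω)
    have h3 := h.trans_le (le_distRV p hp Y ω)
    unfold densRV
    rw [Real.logb_div h1.ne' (mul_pos h2 h3).ne', Real.logb_mul h2.ne' h3.ne']
    ring
  rw [Finset.sum_congr rfl (fun ω _ => this ω), Finset.sum_sub_distrib, Finset.sum_sub_distrib]
  ring

lemma mutInfo_nonneg' {Ω α β : Type} [Fintype Ω] [Fintype α] [Fintype β] (p : Ω → ℝ)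
    (hp : ∀ ω, 0 ≤ p ω) (hp1 : ∑ ω, p ω = 1) (X : Ω → α) (Y : Ω → β) :
    0 ≤ mutInfo p X Y := by
  rw [mutInfo_eq p hp]
  have hlog2 : 0 < Real.log 2 := Real.log_pos (by norm_num)
  have h1 : ∀ ω, p ω * (1 - (densRV p X Y (X ω) (Y ω))⁻¹) / Real.log 2 ≤
      p ω * Real.logb 2 (densRV p X Y (X ω) (Y ω)) := by
    intro ω
    rcases (hp ω).eq_or_lt with h | h
    · simp [← h]
    have hd := densRV_pos p hp X Y ω h
    rw [mul_div_assoc]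
    refine mul_le_mul_of_nonneg_left ?_ (hp ω)
    unfold Real.logb
    exact div_le_div_of_nonneg_right (Real.one_sub_inv_le_log_of_pos hd) hlog2.le
  refine le_trans ?_ (Finset.sum_le_sum fun ω _ => h1 ω)
  rw [← Finset.sum_div]
  refine div_nonneg ?_ hlog2.le
  simp only [mul_sub, mul_one, Finset.sum_sub_distrib, hp1]
  have h2 : ∑ ω, p ω * (densRV p X Y (X ω) (Y ω))⁻¹ ≤ 1 := by
    rw [← distRV_expect p (fun ω => (X ω, Y ω)) (fun c => (densRV p X Y c.1 c.2)⁻¹)]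
    calc _ ≤ ∑ c : α × β, distRV p X c.1 * distRV p Y c.2 := by
          refine Finset.sum_le_sum fun c _ => ?_
          have hX := distRV_nonneg p hp X c.1
          have hY := distRV_nonneg p hp Y c.2
          have hm := densRV_mul p hp X Y c.1 c.2
          rw [show c = (c.1, c.2) from rfl, ← hm]
          by_cases hd : densRV p X Y c.1 c.2 = 0
          · simp only [hd]; simp; positivity
          · rw [mul_assoc, mul_inv_cancel₀ hd, mul_one]
      _ = 1 := by
          rw [Fintype.sum_prod_type]
          simp only [← Finset.mul_sum, distRV_sum p hp1 Y, mul_one, distRV_sum p hp1 X]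
  linarith

lemma good_bound {Ω : Type} [Fintype Ω] (p : Ω → ℝ) (hp0 : ∀ a, 0 ≤ p a) (hp1 : ∑ a, p a = 1)
    (r s : Ω → ℝ)
    (hr : ∀ ω, 0 < p ω → 0 < r ω) (hs : ∀ ω, 0 < p ω → 0 < s ω) :
    ∃ v : ℝ, 0 ≤ v ∧ ∀ (N : ℕ) (δ L M : ℝ), 0 < N → 0 < δ →
      (2 : ℝ) ^ ((N : ℝ) * ((∑ ω, p ω * Real.logb 2 (r ω)) + 2 * δ)) ≤ L → 0 ≤ M →
      M ≤ 4 * (2 : ℝ) ^ ((N : ℝ) * ((∑ ω, p ω * Real.logb 2 (s ω)) - 2 * δ)) →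
      1 - 5 * (2 : ℝ) ^ (-((N : ℝ) * δ)) - v / (N * δ ^ 2) ≤
      ∑ ω : Fin N → Ω, (∏ n, p (ω n)) * ((L / ((∏ n, r (ω n)) + L)) *
        ((∏ n, s (ω n)) / ((∏ n, s (ω n)) + M))) := by
  obtain ⟨v1, hv1, h1⟩ := wlln p hp0 hp1 (fun ω => Real.logb 2 (r ω))
  obtain ⟨v2, hv2, h2⟩ := wlln p hp0 hp1 (fun ω => Real.logb 2 (s ω))
  refine ⟨v1 + v2, by positivity, ?_⟩
  intro N δ L M hN hδ hL hM0 hM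
  have h1 := h1 N δ hN hδ
  have h2 := h2 N δ hN hδ
  set IW := ∑ ω, p ω * Real.logb 2 (r ω)
  set I1 := ∑ ω, p ω * Real.logb 2 (s ω)
  set t := (2 : ℝ) ^ (-((N : ℝ) * δ)) with ht
  have ht0 : 0 < t := Real.rpow_pos_of_pos (by norm_num) _
  have hL0 : 0 < L := lt_of_lt_of_le (Real.rpow_pos_of_pos (by norm_num) _) hL
  have hprod : ∀ (f : Ω → ℝ) (ω : Fin N → Ω), (∀ n, 0 < f (ω n)) →
      ∏ n, f (ω n) = (2 : ℝ) ^ (∑ n, Real.logb 2 (f (ω n))) := by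
    intro f ω hf
    rw [Real.rpow_sum_of_pos (by norm_num)]
    exact Finset.prod_congr rfl fun n _ =>
      (Real.rpow_logb (by norm_num) (by norm_num) (hf n)).symm
  have pt : ∀ ω : Fin N → Ω, (∏ n, p (ω n)) * (1 - 5 * t) -
      (∏ n, p (ω n)) * (if (N : ℝ) * δ ≤ |∑ n, Real.logb 2 (r (ω n)) - N * IW| then (1 : ℝ) else 0)
      - (∏ n, p (ω n)) * (if (N : ℝ) * δ ≤ |∑ n, Real.logb 2 (s (ω n)) - N * I1| then (1 : ℝ) else 0)
      ≤ (∏ n, p (ω n)) * ((L / ((∏ n, r (ω n)) + L)) *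
        ((∏ n, s (ω n)) / ((∏ n, s (ω n)) + M))) := by
    intro ω
    rw [← mul_sub, ← mul_sub]
    have hpn : 0 ≤ ∏ n, p (ω n) := Finset.prod_nonneg fun n _ => hp0 _
    rcases hpn.eq_or_lt with h0 | h0
    · simp [← h0]
    refine mul_le_mul_of_nonneg_left ?_ hpn
    have hpp : ∀ n, 0 < p (ω n) := by
      intro n
      refine lt_of_le_of_ne (hp0 _) fun h => h0.ne' ?_
      exact Finset.prod_eq_zero (Finset.mem_univ n) h.symm
    have hrp := hprod r ω (fun n => hr _ (hpp n))
    have hsp := hprod s ω (fun n => hs _ (hpp n))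
    set a := ∏ n, r (ω n)
    set b := ∏ n, s (ω n)
    have ha : 0 < a := by rw [hrp]; exact Real.rpow_pos_of_pos (by norm_num) _
    have hb : 0 < b := by rw [hsp]; exact Real.rpow_pos_of_pos (by norm_num) _
    have hnn : 0 ≤ L / (a + L) * (b / (b + M)) := by positivity
    split_ifs with c1 c2 c2
    · linarith
    · linarith
    · linarith
    · push Not at c1 c2
      have c1' := (abs_lt.mp c1).2
      have c2' := (abs_lt.mp c2).1
      have haL : a ≤ t * L := by
        calc a ≤ (2 : ℝ) ^ (-((N : ℝ) * δ) + N * (IW + 2 * δ)) := by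
              rw [hrp]
              exact Real.rpow_le_rpow_of_exponent_le (by norm_num) (by linarith)
          _ = t * (2 : ℝ) ^ ((N : ℝ) * (IW + 2 * δ)) := by
              rw [Real.rpow_add (by norm_num)]
          _ ≤ t * L := mul_le_mul_of_nonneg_left hL ht0.le
      have hMb : M ≤ 4 * t * b := by
        have : (2 : ℝ) ^ ((N : ℝ) * (I1 - 2 * δ)) ≤ t * b := by
          rw [hsp, ht, ← Real.rpow_add (by norm_num)]
          exact Real.rpow_le_rpow_of_exponent_le (by norm_num) (by linarith)
        linarith
      have hx : 1 - t ≤ L / (a + L) := by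
        rw [le_div_iff₀ (by positivity)]
        nlinarith [mul_pos ht0 ha]
      have hy : 1 - 4 * t ≤ b / (b + M) := by
        rw [le_div_iff₀ (by positivity)]
        nlinarith [mul_nonneg ht0.le hM0]
      have hx1 : L / (a + L) ≤ 1 := by rw [div_le_one (by positivity)]; linarith
      have hy1 : b / (b + M) ≤ 1 := by rw [div_le_one (by positivity)]; linarith
      nlinarith [mul_nonneg (sub_nonneg.mpr hx1) (sub_nonneg.mpr hy1)]
  refine le_trans ?_ (Finset.sum_le_sum fun ω _ => pt ω)
  rw [Finset.sum_sub_distrib, Finset.sum_sub_distrib, ← Finset.sum_mul, sum_prod0 p hp1, add_div]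
  linarith


lemma Q_sum' (ch : SDBC 𝒳 𝒴1 𝒴2 𝒲) (x : 𝒳) (w : 𝒲) :
    ∑ y1, ∑ y2, ch.Q x w (y1, y2) = 1 := by
  rw [← Fintype.sum_prod_type' (fun y1 y2 => ch.Q x w (y1, y2))]
  exact ch.Q_sum x w

lemma jp_nonneg (ch : SDBC 𝒳 𝒴1 𝒴2 𝒲) {𝒰 : Type} [Fintype 𝒰]
    (pU : 𝒲 → 𝒰 → ℝ) (pX : 𝒲 → 𝒰 → 𝒳 → ℝ)
    (hpU : ∀ w, IsPMF (pU w)) (hpX : ∀ w u, IsPMF (pX w u)) (ω) : 0 ≤ jointP2 ch pU pX ω :=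
  mul_nonneg (mul_nonneg (mul_nonneg (ch.q_pmf.1 _) ((hpU _).1 _)) ((hpX _ _).1 _))
    (ch.Q_nonneg _ _ _)

lemma jp_UW (ch : SDBC 𝒳 𝒴1 𝒴2 𝒲) {𝒰 : Type} [Fintype 𝒰]
    (pU : 𝒲 → 𝒰 → ℝ) (pX : 𝒲 → 𝒰 → 𝒳 → ℝ) (hpX : ∀ w u, IsPMF (pX w u)) (u : 𝒰) (w : 𝒲) :
    distRV (jointP2 ch pU pX) (fun ω => (ω.2.1, ω.1)) (u, w) = ch.q w * pU w u := by
  classical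
  have key : ∀ (w' : 𝒲) (u' : 𝒰), ∑ x, ∑ y1, ∑ y2,
      (jointP2 ch pU pX) (w', u', x, y1, y2) = ch.q w' * pU w' u' := by
    intro w' u'
    simp only [jointP2, ← Finset.mul_sum, Q_sum', mul_one, (hpX w' u').2]
  have e : ∀ (w' : 𝒲) (u' : 𝒰) (c : Prop) [Decidable c], ∑ x, ∑ y1, ∑ y2,
      (if c then (jointP2 ch pU pX) (w', u', x, y1, y2) else 0) =
      if c then ch.q w' * pU w' u' else 0 := by
    intro w' u' c _
    split_ifs
    · exact key w' u'
    · simp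
  have d : distRV (jointP2 ch pU pX) (fun ω => (ω.2.1, ω.1)) (u, w) =
      ∑ w', ∑ u', ∑ x, ∑ y1, ∑ y2,
        (if w' = w ∧ u' = u then (jointP2 ch pU pX) (w', u', x, y1, y2) else 0) := by
    unfold distRV
    simp only [Fintype.sum_prod_type]
    refine Finset.sum_congr rfl fun w' _ => Finset.sum_congr rfl fun u' _ =>
      Finset.sum_congr rfl fun x _ => Finset.sum_congr rfl fun y1 _ =>
      Finset.sum_congr rfl fun y2 _ => ?_
    by_cases h1 : w' = w <;> by_cases h2 : u' = u <;> simp [h1, h2]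
  rw [d]
  simp only [e]
  rw [Finset.sum_eq_single w, Finset.sum_eq_single u]
  · simp
  · intro b _ hb; simp [hb]
  · simp
  · intro b _ hb; simp [hb]
  · simp

lemma jp_W (ch : SDBC 𝒳 𝒴1 𝒴2 𝒲) {𝒰 : Type} [Fintype 𝒰]
    (pU : 𝒲 → 𝒰 → ℝ) (pX : 𝒲 → 𝒰 → 𝒳 → ℝ)
    (hpU : ∀ w, IsPMF (pU w)) (hpX : ∀ w u, IsPMF (pX w u)) (w : 𝒲) :
    distRV (jointP2 ch pU pX) (fun ω => ω.1) w = ch.q w := by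
  rw [← distRV_pair_sum (jointP2 ch pU pX) (fun ω => ω.2.1) (fun ω => ω.1) w]
  simp only [jp_UW ch pU pX hpX, ← Finset.mul_sum, (hpU w).2, mul_one]

lemma jp_sum (ch : SDBC 𝒳 𝒴1 𝒴2 𝒲) {𝒰 : Type} [Fintype 𝒰]
    (pU : 𝒲 → 𝒰 → ℝ) (pX : 𝒲 → 𝒰 → 𝒳 → ℝ)
    (hpU : ∀ w, IsPMF (pU w)) (hpX : ∀ w u, IsPMF (pX w u)) :
    ∑ ω, jointP2 ch pU pX ω = 1 := by
  have := distRV_expect (jointP2 ch pU pX) (fun ω => ω.1) (fun _ => 1)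
  simp only [mul_one] at this
  rw [← this]
  simp only [jp_W ch pU pX hpU hpX, ch.q_pmf.2]

/-- Regrouping of sequences of tuples. -/
def regroup (N : ℕ) (W U X Y1 Y2 : Type) :
    (Fin N → W × U × X × Y1 × Y2) ≃
      ((Fin N → W) × (Fin N → X) × (Fin N → Y1) × (Fin N → Y2)) × (Fin N → U) where
  toFun f := ((fun n => (f n).1, fun n => (f n).2.2.1, fun n => (f n).2.2.2.1,
    fun n => (f n).2.2.2.2), fun n => (f n).2.1)
  invFun g n := (g.1.1 n, g.2 n, g.1.2.1 n, g.1.2.2.1 n, g.1.2.2.2 n)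
  left_inv _ := rfl
  right_inv _ := rfl

lemma nfold (ch : SDBC 𝒳 𝒴1 𝒴2 𝒲) {𝒰 : Type} [Fintype 𝒰]
    (pU : 𝒲 → 𝒰 → ℝ) (pX : 𝒲 → 𝒰 → 𝒳 → ℝ)
    (hpU : ∀ w, IsPMF (pU w)) (hpX : ∀ w u, IsPMF (pX w u)) (N : ℕ) (L M : ℝ)
    (τ : 𝒰 → 𝒴1 → 𝒴2 → ℝ) :
    (∑ s : (Fin N → 𝒲) × (Fin N → 𝒳) × (Fin N → 𝒴1) × (Fin N → 𝒴2),
      (∏ n, ch.q (s.1 n)) * (∏ n, ch.Q (s.2.1 n) (s.1 n) (s.2.2.1 n, s.2.2.2 n)) *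
        (L * ∑ u : Fin N → 𝒰, (∏ n, distRV (jointP2 ch pU pX) (fun ω => ω.2.1) (u n)) *
          ((∏ n, pX (s.1 n) (u n) (s.2.1 n)) *
          ((∏ n, densRV (jointP2 ch pU pX) (fun ω => ω.2.1) (fun ω => ω.1) (u n) (s.1 n)) /
            ((∏ n, densRV (jointP2 ch pU pX) (fun ω => ω.2.1) (fun ω => ω.1) (u n) (s.1 n)) + L)) *
          ((∏ n, τ (u n) (s.2.2.1 n) (s.2.2.2 n)) /
            ((∏ n, τ (u n) (s.2.2.1 n) (s.2.2.2 n)) + M))))) =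
    ∑ ω : Fin N → 𝒲 × 𝒰 × 𝒳 × 𝒴1 × 𝒴2, (∏ n, jointP2 ch pU pX (ω n)) *
      ((L / ((∏ n, densRV (jointP2 ch pU pX) (fun ω => ω.2.1) (fun ω => ω.1)
          (ω n).2.1 (ω n).1) + L)) *
        ((∏ n, τ (ω n).2.1 (ω n).2.2.2.1 (ω n).2.2.2.2) /
          ((∏ n, τ (ω n).2.1 (ω n).2.2.2.1 (ω n).2.2.2.2) + M))) := by
  symm
  simp only [Finset.mul_sum]
  rw [← Fintype.sum_prod_type' (f := fun
    (s : (Fin N → 𝒲) × (Fin N → 𝒳) × (Fin N → 𝒴1) × (Fin N → 𝒴2)) (u : Fin N → 𝒰) =>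
      (∏ n, ch.q (s.1 n)) * (∏ n, ch.Q (s.2.1 n) (s.1 n) (s.2.2.1 n, s.2.2.2 n)) *
        (L * ((∏ n, distRV (jointP2 ch pU pX) (fun ω => ω.2.1) (u n)) *
          ((∏ n, pX (s.1 n) (u n) (s.2.1 n)) *
          ((∏ n, densRV (jointP2 ch pU pX) (fun ω => ω.2.1) (fun ω => ω.1) (u n) (s.1 n)) /
            ((∏ n, densRV (jointP2 ch pU pX) (fun ω => ω.2.1) (fun ω => ω.1) (u n) (s.1 n)) + L)) *
          ((∏ n, τ (u n) (s.2.2.1 n) (s.2.2.2 n)) /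
            ((∏ n, τ (u n) (s.2.2.1 n) (s.2.2.2 n)) + M))))))]
  refine Fintype.sum_equiv (regroup N 𝒲 𝒰 𝒳 𝒴1 𝒴2) _ _ fun ω => ?_
  simp only [regroup, Equiv.coe_fn_mk]
  have e : ∏ n, jointP2 ch pU pX (ω n) =
      (∏ n, ch.q (ω n).1) * (∏ n, ch.Q (ω n).2.2.1 (ω n).1 ((ω n).2.2.2.1, (ω n).2.2.2.2)) *
      ((∏ n, distRV (jointP2 ch pU pX) (fun ω => ω.2.1) (ω n).2.1) *
        ((∏ n, pX (ω n).1 (ω n).2.1 (ω n).2.2.1) *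
        (∏ n, densRV (jointP2 ch pU pX) (fun ω => ω.2.1) (fun ω => ω.1) (ω n).2.1 (ω n).1))) := by
    simp only [← Finset.prod_mul_distrib]
    refine Finset.prod_congr rfl fun n _ => ?_
    have h := densRV_mul (jointP2 ch pU pX) (jp_nonneg ch pU pX hpU hpX) (fun ω => ω.2.1)
      (fun ω => ω.1) (ω n).2.1 (ω n).1
    rw [jp_UW ch pU pX hpX, jp_W ch pU pX hpU hpX] at h
    have e2 : jointP2 ch pU pX (ω n) = (ch.q (ω n).1 * pU (ω n).1 (ω n).2.1) *
      pX (ω n).1 (ω n).2.1 (ω n).2.2.1 *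
      ch.Q (ω n).2.2.1 (ω n).1 ((ω n).2.2.2.1, (ω n).2.2.2.2) := rfl
    rw [e2, ← h]
    ring
  rw [e]
  ring

lemma jointII_sum (ch : SDBC 𝒳 𝒴1 𝒴2 𝒲) {N K1 K2 : ℕ} (hK1 : 0 < K1) (hK2 : 0 < K2)
    (c : CodeII 𝒳 𝒴1 𝒴2 𝒲 N K1 K2) : ∑ ω, jointII ch c ω = 1 := by
  have hQ : ∀ (x : Fin N → 𝒳) (w : Fin N → 𝒲), ∑ y1 : Fin N → 𝒴1, ∑ y2 : Fin N → 𝒴2,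
      ∏ n, ch.Q (x n) (w n) (y1 n, y2 n) = 1 := by
    intro x w
    rw [← Fintype.sum_prod_type' (fun (y1 : Fin N → 𝒴1) (y2 : Fin N → 𝒴2) =>
      ∏ n, ch.Q (x n) (w n) (y1 n, y2 n))]
    have h := sum_pi_prod (fun (n : Fin N) (y : 𝒴1 × 𝒴2) => ch.Q (x n) (w n) y)
    simp only [ch.Q_sum, Finset.prod_const_one] at h
    rw [← h]
    exact (Fintype.sum_equiv (Equiv.arrowProdEquivProdArrow (Fin N) (fun _ => 𝒴1) (fun _ => 𝒴2)) _ _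
      fun y => rfl).symm
  simp only [Fintype.sum_prod_type, jointII, ← Finset.mul_sum, hQ, mul_one]
  rw [sum_prod0 ch.q ch.q_pmf.2]
  have h1 : (K1 : ℝ) ≠ 0 := by positivity
  have h2 : (K2 : ℝ) ≠ 0 := by positivity
  simp
  field_simp

lemma err_eq (ch : SDBC 𝒳 𝒴1 𝒴2 𝒲) {N K1 K2 : ℕ} (hK1 : 0 < K1) (hK2 : 0 < K2)
    (c : CodeII 𝒳 𝒴1 𝒴2 𝒲 N K1 K2)
    (p : Fin K1 × Fin K2 × (Fin N → 𝒲) × (Fin N → 𝒴1) × (Fin N → 𝒴2) → Prop) [DecidablePred p]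
    [DecidablePred fun ω => ¬ p ω] :
    (∑ ω, if ¬ p ω then jointII ch c ω else 0) =
      1 - ∑ ω, jointII ch c ω * (if p ω then 1 else 0) := by
  refine eq_sub_of_add_eq (Eq.trans ?_ (jointII_sum ch hK1 hK2 c))
  rw [← Finset.sum_add_distrib]
  refine Finset.sum_congr rfl fun ω _ => ?_
  by_cases h : p ω <;> simp [h]

lemma enc_collapse (ch : SDBC 𝒳 𝒴1 𝒴2 𝒲) {N K1 K2 : ℕ} (c : CodeII 𝒳 𝒴1 𝒴2 𝒲 N K1 K2)
    [DecidableEq (Fin N → 𝒳)]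
    (f : Fin K1 × Fin K2 × (Fin N → 𝒲) × (Fin N → 𝒴1) × (Fin N → 𝒴2) → ℝ) :
    ∑ t : (Fin K1 × Fin K2) × (Fin N → 𝒲) × (Fin N → 𝒳) × (Fin N → 𝒴1) × (Fin N → 𝒴2),
        (if c.enc t.1.1 t.1.2 t.2.1 = t.2.2.1 then 1 else 0) *
        ((K1 : ℝ)⁻¹ * (K2 : ℝ)⁻¹ * ((∏ n, ch.q (t.2.1 n)) *
          ∏ n, ch.Q (t.2.2.1 n) (t.2.1 n) (t.2.2.2.1 n, t.2.2.2.2 n)) *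
          f (t.1.1, t.1.2, t.2.1, t.2.2.2.1, t.2.2.2.2)) =
    ∑ ω, jointII ch c ω * f ω := by
  simp only [Fintype.sum_prod_type, jointII]
  refine Finset.sum_congr rfl fun m1 _ => Finset.sum_congr rfl fun m2 _ =>
    Finset.sum_congr rfl fun w _ => ?_
  rw [Finset.sum_eq_single (c.enc m1 m2 w)]
  · simp only [if_true, one_mul, mul_assoc]
  · intro b _ hb
    simp [hb.symm]
  · simp


lemma sum_prod_le_one {U Y : Type} [Fintype U] {N : ℕ} (P : U → ℝ) (σ : U → Y → ℝ)
    (hP : ∀ u, 0 ≤ P u) (hσ : ∀ u y, 0 ≤ σ u y) (h : ∀ y, ∑ u, P u * σ u y ≤ 1) (y : Fin N → Y) :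
    ∑ u : Fin N → U, (∏ n, P (u n)) * ∏ n, σ (u n) (y n) ≤ 1 := by
  simp only [← Finset.prod_mul_distrib]
  rw [sum_pi_prod (fun n u => P u * σ u (y n))]
  exact Finset.prod_le_one
    (fun n _ => Finset.sum_nonneg fun u _ => mul_nonneg (hP _) (hσ _ _)) (fun n _ => h _)

lemma achiev (ch : SDBC 𝒳 𝒴1 𝒴2 𝒲) {𝒰 : Type} [Fintype 𝒰]
    (pU : 𝒲 → 𝒰 → ℝ) (pX : 𝒲 → 𝒰 → 𝒳 → ℝ)
    (hpU : ∀ w, IsPMF (pU w)) (hpX : ∀ w u, IsPMF (pX w u)) (R1 R2 δ : ℝ) (hδ : 0 < δ)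
    (hR1 : 0 ≤ R1) (hR2 : 0 ≤ R2)
    (h1 : R1 = 0 ∨ R1 + 4 * δ ≤
      mutInfo (jointP2 ch pU pX) (fun ω => ω.2.1) (fun ω => ω.2.2.2.1)
              - mutInfo (jointP2 ch pU pX) (fun ω => ω.2.1) (fun ω => ω.1))
    (h2 : R2 = 0 ∨ R2 + 4 * δ ≤
      mutInfo (jointP2 ch pU pX) (fun ω => ω.2.1) (fun ω => ω.2.2.2.2)
              - mutInfo (jointP2 ch pU pX) (fun ω => ω.2.1) (fun ω => ω.1)) :
    AchievableII ch R1 R2 := by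
  refine ⟨hR1, hR2, ?_⟩
  intro ε hε
  have hp0 := jp_nonneg ch pU pX hpU hpX
  have hp1 := jp_sum ch pU pX hpU hpX
  have hWne : Nonempty 𝒲 := by
    by_contra hne
    rw [not_nonempty_iff] at hne
    have := ch.q_pmf.2
    simp at this
  have hUne : Nonempty 𝒰 := by
    by_contra hne
    rw [not_nonempty_iff] at hne
    have := (hpU hWne.some).2
    simp at this
  have hXne : Nonempty 𝒳 := by
    by_contra hne
    rw [not_nonempty_iff] at hne
    have := (hpX hWne.some hUne.some).2
    simp at this
  set p := jointP2 ch pU pX with hpdef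
  set ρ := densRV p (fun ω => ω.2.1) (fun ω => ω.1) with hρdef
  set σ1 := densRV p (fun ω => ω.2.1) (fun ω => ω.2.2.2.1) with hσ1def
  set σ2 := densRV p (fun ω => ω.2.1) (fun ω => ω.2.2.2.2) with hσ2def
  set P := distRV p (fun ω => ω.2.1) with hPdef
  have hIW0 := mutInfo_nonneg' p hp0 hp1 (fun ω => ω.2.1) (fun ω => ω.1)
  have mW := mutInfo_eq p hp0 (fun ω => ω.2.1) (fun ω => ω.1)
  have m1 := mutInfo_eq p hp0 (fun ω => ω.2.1) (fun ω => ω.2.2.2.1)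
  have m2 := mutInfo_eq p hp0 (fun ω => ω.2.1) (fun ω => ω.2.2.2.2)
  set IW := mutInfo p (fun ω => ω.2.1) (fun ω => ω.1) with hIW
  set I1 := mutInfo p (fun ω => ω.2.1) (fun ω => ω.2.2.2.1) with hI1
  set I2 := mutInfo p (fun ω => ω.2.1) (fun ω => ω.2.2.2.2) with hI2
  obtain ⟨v1, hv1, g1⟩ := good_bound p hp0 hp1 (fun ω => ρ ω.2.1 ω.1)
    (fun ω => σ1 ω.2.1 ω.2.2.2.1)
    (fun ω h => densRV_pos p hp0 (fun ω => ω.2.1) (fun ω => ω.1) ω h)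
    (fun ω h => densRV_pos p hp0 (fun ω => ω.2.1) (fun ω => ω.2.2.2.1) ω h)
  obtain ⟨v2, hv2, g2⟩ := good_bound p hp0 hp1 (fun ω => ρ ω.2.1 ω.1)
    (fun ω => σ2 ω.2.1 ω.2.2.2.2)
    (fun ω h => densRV_pos p hp0 (fun ω => ω.2.1) (fun ω => ω.1) ω h)
    (fun ω h => densRV_pos p hp0 (fun ω => ω.2.1) (fun ω => ω.2.2.2.2) ω h)
  -- the limit
  have hlim : Filter.Tendsto (fun N : ℕ => (5 * (2 : ℝ) ^ (-((N : ℝ) * δ)) + v1 / (N * δ ^ 2)) +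
      (5 * (2 : ℝ) ^ (-((N : ℝ) * δ)) + v2 / (N * δ ^ 2))) Filter.atTop (nhds 0) := by
    have a1 : Filter.Tendsto (fun N : ℕ => (2 : ℝ) ^ (-((N : ℝ) * δ))) Filter.atTop (nhds 0) := by
      have hb : (2 : ℝ) ^ (-δ) < 1 := Real.rpow_lt_one_of_one_lt_of_neg (by norm_num) (by linarith)
      have := tendsto_pow_atTop_nhds_zero_of_lt_one
        (Real.rpow_nonneg (by norm_num : (0 : ℝ) ≤ 2) (-δ)) hb
      refine this.congr fun N => ?_
      rw [← Real.rpow_natCast, ← Real.rpow_mul (by norm_num)]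
      congr 1; ring
    have a2 : ∀ v : ℝ, Filter.Tendsto (fun N : ℕ => v / (N * δ ^ 2)) Filter.atTop (nhds 0) := by
      intro v
      have := tendsto_const_div_atTop_nhds_zero_nat (v / δ ^ 2)
      refine this.congr fun N => ?_
      rw [div_div, mul_comm]
    have := ((a1.const_mul 5).add (a2 v1)).add ((a1.const_mul 5).add (a2 v2))
    simpa using this
  obtain ⟨N0, hN0⟩ := Filter.eventually_atTop.mp (hlim.eventually (gt_mem_nhds hε))
  refine ⟨max N0 1, fun N hN => ?_⟩
  have hNε := hN0 N (le_trans (le_max_left _ _) hN)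
  have hNpos : 0 < N := lt_of_lt_of_le Nat.one_pos (le_trans (le_max_right _ _) hN)
  have hNR : (0 : ℝ) < N := by exact_mod_cast hNpos
  set K1 := ⌈(2 : ℝ) ^ ((N : ℝ) * R1)⌉₊ with hK1
  set K2 := ⌈(2 : ℝ) ^ ((N : ℝ) * R2)⌉₊ with hK2
  set L := ⌈(2 : ℝ) ^ ((N : ℝ) * (IW + 2 * δ))⌉₊ with hL
  have hK1p : 0 < K1 := Nat.ceil_pos.mpr (Real.rpow_pos_of_pos (by norm_num) _)
  have hK2p : 0 < K2 := Nat.ceil_pos.mpr (Real.rpow_pos_of_pos (by norm_num) _)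
  have ceil2 : ∀ x : ℝ, 0 ≤ x → (⌈(2 : ℝ) ^ x⌉₊ : ℝ) ≤ 2 * (2 : ℝ) ^ x := by
    intro x hx
    have h1 : 1 ≤ (2 : ℝ) ^ x := Real.one_le_rpow (by norm_num) hx
    have := (Nat.ceil_lt_add_one (by linarith : 0 ≤ (2 : ℝ) ^ x)).le
    linarith
  have hKL : ∀ R I : ℝ, 0 ≤ R → R + 4 * δ ≤ I - IW →
      (⌈(2 : ℝ) ^ ((N : ℝ) * R)⌉₊ : ℝ) * L ≤ 4 * (2 : ℝ) ^ ((N : ℝ) * (I - 2 * δ)) := by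
    intro R I hR hRI
    have a := ceil2 (N * R) (by positivity)
    have b := ceil2 (N * (IW + 2 * δ)) (by positivity)
    calc (⌈(2 : ℝ) ^ ((N : ℝ) * R)⌉₊ : ℝ) * L ≤
          (2 * (2 : ℝ) ^ ((N : ℝ) * R)) * (2 * (2 : ℝ) ^ ((N : ℝ) * (IW + 2 * δ))) :=
        mul_le_mul a b (by positivity) (by positivity)
      _ = 4 * (2 : ℝ) ^ ((N : ℝ) * R + (N : ℝ) * (IW + 2 * δ)) := by
        rw [Real.rpow_add (by norm_num)]; ring
      _ ≤ _ := by
        refine mul_le_mul_of_nonneg_left ?_ (by norm_num)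
        refine Real.rpow_le_rpow_of_exponent_le (by norm_num) ?_
        rw [← mul_add]
        exact mul_le_mul_of_nonneg_left (by linarith) hNR.le
  set A1 : ℝ := if R1 = 0 then 0 else 1 with hA1
  set A2 : ℝ := if R2 = 0 then 0 else 1 with hA2
  have hA10 : 0 ≤ A1 := by rw [hA1]; split_ifs <;> norm_num
  have hA20 : 0 ≤ A2 := by rw [hA2]; split_ifs <;> norm_num
  have hA11 : A1 ≤ 1 := by rw [hA1]; split_ifs <;> norm_num
  have hA21 : A2 ≤ 1 := by rw [hA2]; split_ifs <;> norm_num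
  have hP0 : ∀ u, 0 ≤ P u := fun u => distRV_nonneg p hp0 _ _
  have hP1 : ∑ u, P u = 1 := distRV_sum p hp1 _
  have hρ0 : ∀ u w, 0 ≤ ρ u w := fun u w => densRV_nonneg p hp0 _ _ _ _
  have hσ10 : ∀ u w, 0 ≤ σ1 u w := fun u w => densRV_nonneg p hp0 _ _ _ _
  have hσ20 : ∀ u w, 0 ≤ σ2 u w := fun u w => densRV_nonneg p hp0 _ _ _ _
  have hpX1 : ∀ (w : Fin N → 𝒲) (u : Fin N → 𝒰),
      ∑ x : Fin N → 𝒳, ∏ n, pX (w n) (u n) (x n) = 1 := by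
    intro w u
    rw [sum_pi_prod (fun n x => pX (w n) (u n) x)]
    simp [(hpX _ _).2]
  obtain ⟨enc, dec1, dec2, hcode⟩ := oneshot (W := Fin N → 𝒲) (U := Fin N → 𝒰) (X := Fin N → 𝒳)
    (Y1 := Fin N → 𝒴1) (Y2 := Fin N → 𝒴2)
    (fun w => ∏ n, ch.q (w n)) (fun w => Finset.prod_nonneg fun n _ => ch.q_pmf.1 _)
    (fun w u x => ∏ n, pX (w n) (u n) (x n))
    (fun w u x => Finset.prod_nonneg fun n _ => (hpX _ _).1 _) hpX1
    (fun x w y1 y2 => ∏ n, ch.Q (x n) (w n) (y1 n, y2 n))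
    (fun x w y1 y2 => Finset.prod_nonneg fun n _ => ch.Q_nonneg _ _ _)
    (fun u => ∏ n, P (u n)) (fun u => Finset.prod_nonneg fun n _ => hP0 _) (sum_prod0 P hP1)
    (fun u w => ∏ n, ρ (u n) (w n)) (fun u w => Finset.prod_nonneg fun n _ => hρ0 _ _)
    (sum_prod_le_one P ρ hP0 hρ0 (densRV_sum p hp0 _ _))
    (fun u y => ∏ n, σ1 (u n) (y n)) (fun u w => Finset.prod_nonneg fun n _ => hσ10 _ _)
    (sum_prod_le_one P σ1 hP0 hσ10 (densRV_sum p hp0 _ _))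
    (fun u y => ∏ n, σ2 (u n) (y n)) (fun u w => Finset.prod_nonneg fun n _ => hσ20 _ _)
    (sum_prod_le_one P σ2 hP0 hσ20 (densRV_sum p hp0 _ _))
    K1 K2 L hK1p hK2p A1 A2 hA10 hA20
  set c : CodeII 𝒳 𝒴1 𝒴2 𝒲 N K1 K2 :=
    { enc := fun m1 m2 w => enc (m1, m2, w)
      dec1 := fun y m2 => dec1 (y, m2)
      dec2 := fun y m1 => dec2 (y, m1) } with hc
  have n1 := nfold ch pU pX hpU hpX N L (K1 * L) (fun u y1 _ => σ1 u y1)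
  have n2 := nfold ch pU pX hpU hpX N L (K2 * L) (fun u _ y2 => σ2 u y2)
  have coll := enc_collapse ch c (fun ω => A1 * (if dec1 (ω.2.2.2.1, ω.2.1) = ω.1 then 1 else 0) +
           A2 * (if dec2 (ω.2.2.2.2, ω.1) = ω.2.1 then 1 else 0))
  have er1 := err_eq ch hK1p hK2p c (fun ω => c.dec1 ω.2.2.2.1 ω.2.1 = ω.1)
  have er2 := err_eq ch hK1p hK2p c (fun ω => c.dec2 ω.2.2.2.2 ω.1 = ω.2.1)
  have hjn : ∀ ω, 0 ≤ jointII ch c ω := fun ω => by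
    have := Finset.prod_nonneg (fun n (_ : n ∈ Finset.univ) => ch.q_pmf.1 (ω.2.2.1 n))
    have := Finset.prod_nonneg (fun n (_ : n ∈ Finset.univ) =>
      ch.Q_nonneg (c.enc ω.1 ω.2.1 ω.2.2.1 n) (ω.2.2.1 n) (ω.2.2.2.1 n, ω.2.2.2.2 n))
    unfold jointII
    positivity
  have hcode' := hcode.trans_eq coll
  rw [n1, n2] at hcode'
  have split : ∑ ω, jointII ch c ω * (A1 * (if dec1 (ω.2.2.2.1, ω.2.1) = ω.1 then 1 else 0) +
           A2 * (if dec2 (ω.2.2.2.2, ω.1) = ω.2.1 then 1 else 0)) =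
      A1 * (∑ ω, jointII ch c ω * (if c.dec1 ω.2.2.2.1 ω.2.1 = ω.1 then 1 else 0)) +
      A2 * (∑ ω, jointII ch c ω * (if c.dec2 ω.2.2.2.2 ω.1 = ω.2.1 then 1 else 0)) := by
    rw [Finset.mul_sum, Finset.mul_sum, ← Finset.sum_add_distrib]
    refine Finset.sum_congr rfl fun ω _ => ?_
    simp only [hc]; ring
  rw [split] at hcode'
  set e1 := ∑ ω, (if ¬ c.dec1 ω.2.2.2.1 ω.2.1 = ω.1 then jointII ch c ω else 0) with he1
  set e2 := ∑ ω, (if ¬ c.dec2 ω.2.2.2.2 ω.1 = ω.2.1 then jointII ch c ω else 0) with he2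
  have he10 : 0 ≤ e1 := Finset.sum_nonneg fun ω _ => by split_ifs; exacts [le_rfl, hjn ω]
  have he20 : 0 ≤ e2 := Finset.sum_nonneg fun ω _ => by split_ifs; exacts [le_rfl, hjn ω]
  rw [show (∑ ω, jointII ch c ω * (if c.dec1 ω.2.2.2.1 ω.2.1 = ω.1 then (1 : ℝ) else 0)) = 1 - e1 by
      linarith,
    show (∑ ω, jointII ch c ω * (if c.dec2 ω.2.2.2.2 ω.1 = ω.2.1 then (1 : ℝ) else 0)) = 1 - e2 by
      linarith] at hcode'
  set t := (2 : ℝ) ^ (-((N : ℝ) * δ)) with ht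
  have ht0 : 0 < t := Real.rpow_pos_of_pos (by norm_num) _
  have hw1 : 0 ≤ 5 * t + v1 / (N * δ ^ 2) := by positivity
  have hw2 : 0 ≤ 5 * t + v2 / (N * δ ^ 2) := by positivity
  have b1 := g1 N δ L (K1 * L) hNpos hδ (by rw [← mW]; exact Nat.le_ceil _) (by positivity)
  have b2 := g2 N δ L (K2 * L) hNpos hδ (by rw [← mW]; exact Nat.le_ceil _) (by positivity)
  rw [← m1] at b1
  rw [← m2] at b2
  have tot : A1 * (1 - (5 * t + v1 / (N * δ ^ 2))) + A2 * (1 - (5 * t + v2 / (N * δ ^ 2))) ≤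
      A1 * (1 - e1) + A2 * (1 - e2) := by
    refine le_trans (add_le_add ?_ ?_) hcode'
    · by_cases hz : R1 = 0
      · rw [show A1 = 0 by simp [hA1, hz], zero_mul, zero_mul]
      · exact mul_le_mul_of_nonneg_left (le_trans (le_of_eq (by rw [ht]; ring))
          (b1 (hKL R1 I1 hR1 (h1.resolve_left hz)))) hA10
    · by_cases hz : R2 = 0
      · rw [show A2 = 0 by simp [hA2, hz], zero_mul, zero_mul]
      · exact mul_le_mul_of_nonneg_left (le_trans (le_of_eq (by rw [ht]; ring))
          (b2 (hKL R2 I2 hR2 (h2.resolve_left hz)))) hA20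
  have q1 : A1 * (5 * t + v1 / (N * δ ^ 2)) ≤ 5 * t + v1 / (N * δ ^ 2) :=
    mul_le_of_le_one_left hw1 hA11
  have q2 : A2 * (5 * t + v2 / (N * δ ^ 2)) ≤ 5 * t + v2 / (N * δ ^ 2) :=
    mul_le_of_le_one_left hw2 hA21
  have r1 : 0 ≤ A1 * e1 := mul_nonneg hA10 he10
  have r2 : 0 ≤ A2 * e2 := mul_nonneg hA20 he20
  refine ⟨K1, K2, c, Nat.le_ceil _, Nat.le_ceil _, ?_⟩
  refine max_le ?_ ?_
  · change e1 ≤ ε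
    by_cases hz : R1 = 0
    · have hKone : K1 = 1 := by simp [hK1, hz]
      have : Subsingleton (Fin K1) := by rw [hKone]; infer_instance
      have : e1 = 0 := Finset.sum_eq_zero fun ω _ => by
        rw [if_neg (not_not.mpr (Subsingleton.elim _ _))]
      linarith
    · have : A1 * e1 = e1 := by simp [hA1, hz]
      linarith
  · change e2 ≤ ε
    by_cases hz : R2 = 0
    · have hKone : K2 = 1 := by simp [hK2, hz]
      have : Subsingleton (Fin K2) := by rw [hKone]; infer_instance
      have : e2 = 0 := Finset.sum_eq_zero fun ω _ => by
        rw [if_neg (not_not.mpr (Subsingleton.elim _ _))]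
      linarith
    · have : A2 * e2 = e2 := by simp [hA2, hz]
      linarith

end Helpers

/-- **Theorem 4 (inner bound for Class II channels).**
For every distribution `p2 ∈ P2` (given by a finite auxiliary alphabet `𝒰` and
conditional pmfs `p(u|w)`, `p(x|w,u)`), the convex hull of the set of nonnegative
rate pairs `(R1,R2)` with `R1 ≤ I(U;Y1) − I(U;W)` and `R2 ≤ I(U;Y2) − I(U;W)`
is contained in the capacity region `C2`; equivalently, the union over all
`p2 ∈ P2` of these convex hulls is contained in `C2`. -/
theorem classII_inner_bound (ch : SDBC 𝒳 𝒴1 𝒴2 𝒲)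
    (𝒰 : Type) [Fintype 𝒰]
    (pU : 𝒲 → 𝒰 → ℝ) (pX : 𝒲 → 𝒰 → 𝒳 → ℝ)
    (hpU : ∀ w, IsPMF (pU w)) (hpX : ∀ w u, IsPMF (pX w u)) :
    convexHull ℝ { R : ℝ × ℝ |
      0 ≤ R.1 ∧ 0 ≤ R.2 ∧
      R.1 ≤ mutInfo (jointP2 ch pU pX) (fun ω => ω.2.1) (fun ω => ω.2.2.2.1)
              - mutInfo (jointP2 ch pU pX) (fun ω => ω.2.1) (fun ω => ω.1) ∧
      R.2 ≤ mutInfo (jointP2 ch pU pX) (fun ω => ω.2.1) (fun ω => ω.2.2.2.2)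
              - mutInfo (jointP2 ch pU pX) (fun ω => ω.2.1) (fun ω => ω.1) }
      ⊆ CapacityII ch := by
  set B1 := mutInfo (jointP2 ch pU pX) (fun ω => ω.2.1) (fun ω => ω.2.2.2.1)
              - mutInfo (jointP2 ch pU pX) (fun ω => ω.2.1) (fun ω => ω.1) with hB1
  set B2 := mutInfo (jointP2 ch pU pX) (fun ω => ω.2.1) (fun ω => ω.2.2.2.2)
              - mutInfo (jointP2 ch pU pX) (fun ω => ω.2.1) (fun ω => ω.1) with hB2
  have hconv : Convex ℝ {R : ℝ × ℝ | 0 ≤ R.1 ∧ 0 ≤ R.2 ∧ R.1 ≤ B1 ∧ R.2 ≤ B2} := by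
    have : {R : ℝ × ℝ | 0 ≤ R.1 ∧ 0 ≤ R.2 ∧ R.1 ≤ B1 ∧ R.2 ≤ B2} =
        Set.Icc ((0, 0) : ℝ × ℝ) (B1, B2) := by
      ext R
      simp only [Set.mem_ofPred_eq, Set.mem_Icc, Prod.le_def]
      tauto
    rw [this]
    exact convex_Icc _ _
  rw [hconv.convexHull_eq]
  rintro ⟨R1, R2⟩ ⟨h1, h2, h3, h4⟩
  simp only at h1 h2 h3 h4
  refine Metric.mem_closure_iff.mpr fun ε hε => ?_
  have hd : (0 : ℝ) < ε / 8 := by linarith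
  refine ⟨(max (R1 - 4 * (ε / 8)) 0, max (R2 - 4 * (ε / 8)) 0), ?_, ?_⟩
  · refine achiev ch pU pX hpU hpX _ _ (ε / 8) hd (le_max_right _ _) (le_max_right _ _) ?_ ?_
    · rcases le_total (R1 - 4 * (ε / 8)) 0 with h | h
      · left; exact max_eq_right h
      · right; rw [max_eq_left h]; linarith
    · rcases le_total (R2 - 4 * (ε / 8)) 0 with h | h
      · left; exact max_eq_right h
      · right; rw [max_eq_left h]; linarith
  · have key : ∀ R : ℝ, 0 ≤ R → dist R (max (R - 4 * (ε / 8)) 0) < ε := by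
      intro R hR
      rw [Real.dist_eq, abs_lt]
      rcases le_total (R - 4 * (ε / 8)) 0 with h | h
      · rw [max_eq_right h]; constructor <;> linarith
      · rw [max_eq_left h]; constructor <;> linarith
    rw [Prod.dist_eq]
    exact max_lt (key R1 h1) (key R2 h2)
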